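/- There exists an integer ℓ₀ (one may take ℓ₀ = 20000) such that for every integer ℓ ≥ ℓ₀ there exist a positive integer d and a constant c > 0 for which infinitely many positive integers n admit a connected d-regular graph on n vertices whose adjacency matrix has second largest eigenvalue exactly ℓ, occurring with eigenvalue multiplicity at least c·log(log n). -/

import Mathlib

/-- The adjacency matrix of a finite simple graph, with real entries. -/
noncomputable def adjMat {V : Type*} [Fintype V] (G : SimpleGraph V) : Matrix V V ℝ :=
  letI := Classical.decRel G.Adj
  G.adjMatrix ℝ

noncomputable def deg {V : Type*} [Fintype V] (G : SimpleGraph V) (v : V) : ℕ :=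
  letI := Classical.decRel G.Adj
  G.degree v

/-- `G` is `d`-regular. -/
def IsRegularGraph {V : Type*} [Fintype V] (G : SimpleGraph V) (d : ℕ) : Prop :=
  ∀ v, deg G v = d

/-- The eigenvalues of a real (symmetric) matrix, i.e. the real roots of its characteristic
polynomial with multiplicity, listed in decreasing order. -/
noncomputable def eigList {V : Type*} [Fintype V] [DecidableEq V] (A : Matrix V V ℝ) : List ℝ :=
  (A.charpoly.roots.sort (· ≤ ·)).reverse

/-- `lam A i` is `λ_i(A)`, the `i`-th largest eigenvalue (counted with multiplicity, 1-indexed)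
of a real symmetric matrix `A`. -/
noncomputable def lam {V : Type*} [Fintype V] [DecidableEq V] (A : Matrix V V ℝ) (i : ℕ) : ℝ :=
  (eigList A).getD (i - 1) 0

/-- The multiplicity of `μ` as an eigenvalue of `A`: the dimension of the `μ`-eigenspace. -/
noncomputable def eigMult {V : Type*} [Fintype V] [DecidableEq V] (A : Matrix V V ℝ) (μ : ℝ) : ℕ :=
  Module.finrank ℝ (Module.End.eigenspace (Matrix.mulVecLin A) μ)


lemma mem_roots_of_eig {n : ℕ} (A : Matrix (Fin n) (Fin n) ℝ) (f : Fin n → ℝ) (hf : f ≠ 0) (l : ℝ)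
    (h : A.mulVec f = l • f) : l ∈ A.charpoly.roots := by
  have h1 : Module.End.HasEigenvalue (Matrix.toLin' A) l := by
    apply Module.End.hasEigenvalue_of_hasEigenvector (x := f)
    refine ⟨?_, hf⟩
    rw [Module.End.mem_eigenspace_iff]
    simpa using h
  rw [Polynomial.mem_roots (Matrix.charpoly_monic A).ne_zero]
  rw [Module.End.hasEigenvalue_iff_isRoot_charpoly] at h1
  simpa using h1

lemma lam_two {n : ℕ} (A : Matrix (Fin n) (Fin n) ℝ) (hA : A.IsHermitian) (l d : ℝ) (hld : l < d)
    (f g : Fin n → ℝ) (hf : f ≠ 0) (hg : g ≠ 0) (hfd : A.mulVec f = d • f) (hgl : A.mulVec g = l • g)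
    (h1 : ∀ (f : Fin n → ℝ) (m : ℝ), A.mulVec f = m • f → l < m → ∃ c, ∀ v, f v = c) :
    lam A 2 = l := by
  classical
  have hd := mem_roots_of_eig A f hf d hfd
  have hl := mem_roots_of_eig A g hg l hgl
  have hcount : A.charpoly.roots.countP (fun x => l < x) ≤ 1 := by
    rw [hA.roots_charpoly_eq_eigenvalues, Multiset.countP_map]
    change (Finset.univ.filter _).card ≤ 1
    rw [Finset.card_le_one]
    intro i hi j hj
    by_contra hij
    simp at hi hj
    have hvi := hA.mulVec_eigenvectorBasis i
    have hvj := hA.mulVec_eigenvectorBasis j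
    obtain ⟨c, hc⟩ := h1 _ _ hvi hi
    obtain ⟨c', hc'⟩ := h1 _ _ hvj hj
    have ho := hA.eigenvectorBasis.orthonormal
    have h0 : inner ℝ (hA.eigenvectorBasis i) (hA.eigenvectorBasis j) = 0 := ho.2 hij
    have hni := ho.1 i
    have hnj := ho.1 j
    rw [PiLp.inner_apply] at h0
    simp [hc, hc'] at h0
    rw [EuclideanSpace.norm_eq] at hni hnj
    simp [hc] at hni
    simp [hc'] at hnj
    rcases h0 with h0 | h0 | h0
    · subst h0; exact i.elim0
    · subst h0; simp at hnj
    · subst h0; simp at hni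
  unfold lam
  have hmem : ∀ x, x ∈ eigList A ↔ x ∈ A.charpoly.roots := by
    intro x; simp [eigList]
  have hsort : (eigList A).Pairwise (· ≥ ·) := by
    unfold eigList
    rw [List.pairwise_reverse]
    exact Multiset.pairwise_sort _ _
  have hcount2 : (eigList A).countP (fun x => l < x) ≤ 1 := by
    unfold eigList
    rw [List.countP_reverse]
    have : A.charpoly.roots.countP (fun x => l < x) = ((A.charpoly.roots.sort (· ≤ ·) : List ℝ) : Multiset ℝ).countP (fun x => l < x) := by
      rw [Multiset.sort_eq]
    rw [this, Multiset.coe_countP] at hcount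
    exact hcount
  have hd' := (hmem d).2 hd
  have hl' := (hmem l).2 hl
  generalize eigList A = L at *
  match L, hsort, hcount2, hd', hl' with
  | [], _, _, hd', _ => simp at hd'
  | [a], _, _, hd', hl' =>
    simp at hd' hl'
    linarith
  | a :: b :: L', hs, hc, hd', hl' =>
    simp only [List.pairwise_cons, List.mem_cons] at hs hd' hl'
    have ha : d ≤ a := by
      rcases hd' with h | h
      · exact h.le
      · exact hs.1 _ h
    have hb : ¬ l < b := by
      intro hb
      have : l < a := by linarith
      simp [hb, this] at hc
    have hlb : l ≤ b := by
      rcases hl' with h | h | h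
      · linarith
      · exact h.le
      · exact hs.2.1 _ h
    simp
    linarith

lemma assemble {n : ℕ} {K : Type*} [Fintype K] (nb : Fin n → K → Fin n)
    (hinj : ∀ v, Function.Injective (nb v)) (hne : ∀ v k, nb v k ≠ v) (inv : K → K)
    (hinv : ∀ v k, nb (nb v k) (inv k) = v) (l : ℕ) (hl : l < Fintype.card K) (hn : 0 < n)
    (h1 : ∀ (f : Fin n → ℝ) (m : ℝ), (∀ v, ∑ k, f (nb v k) = m * f v) → (l : ℝ) < m →
      ∃ c, ∀ v, f v = c)
    {I : Type*} [Fintype I] [Nonempty I] (φ : I → Fin n → ℝ) (hφ : LinearIndependent ℝ φ)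
    (hφl : ∀ i v, ∑ k, φ i (nb v k) = l * φ i v) :
    ∃ G : SimpleGraph (Fin n), G.Connected ∧ IsRegularGraph G (Fintype.card K) ∧
          lam (adjMat G) 2 = (l : ℝ) ∧ Fintype.card I ≤ eigMult (adjMat G) (l : ℝ) := by
  classical
  let G : SimpleGraph (Fin n) :=
    { Adj := fun v w => ∃ k, nb v k = w
      symm := ⟨by
        rintro v w ⟨k, rfl⟩
        exact ⟨inv k, hinv v k⟩⟩
      loopless := ⟨by
        rintro v ⟨k, hk⟩
        exact hne v k hk⟩ }
  have hA : ∀ f : Fin n → ℝ, (adjMat G).mulVec f = fun v => ∑ k, f (nb v k) := by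
    intro f
    funext v
    unfold adjMat
    rw [SimpleGraph.adjMatrix_mulVec_apply]
    let _ := Classical.decRel G.Adj
    have : G.neighborFinset v = Finset.univ.image (nb v) := by
      ext w
      simp [G]
    rw [this, Finset.sum_image]
    intro a _ b _ hab
    exact hinj v hab
  have hdeg : IsRegularGraph G (Fintype.card K) := by
    intro v
    unfold deg
    rw [← SimpleGraph.card_neighborFinset_eq_degree]
    let _ := Classical.decRel G.Adj
    have : G.neighborFinset v = Finset.univ.image (nb v) := by
      ext w
      simp [G]
    rw [this, Finset.card_image_of_injective _ (hinj v)]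
    rfl
  have hld : (l : ℝ) < (Fintype.card K : ℝ) := by exact_mod_cast hl
  refine ⟨G, ?_, hdeg, ?_, ?_⟩
  · have : Nonempty (Fin n) := ⟨⟨0, hn⟩⟩
    refine ⟨?_⟩
    intro v w
    obtain ⟨c, hc⟩ := h1 (fun u => if G.Reachable v u then 1 else 0) (Fintype.card K) (by
      intro u
      have : ∀ k, G.Reachable v (nb u k) ↔ G.Reachable v u := by
        intro k
        have hadj : G.Adj u (nb u k) := ⟨k, rfl⟩
        exact ⟨fun h => h.trans hadj.symm.reachable, fun h => h.trans hadj.reachable⟩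
      simp [this]) hld
    have hv := hc v
    have hw := hc w
    simp at hv
    rw [← hv] at hw
    by_contra hcon
    simp [hcon] at hw
  · obtain ⟨i⟩ := ‹Nonempty I›
    refine lam_two (adjMat G) ?_ l (Fintype.card K) hld (fun _ => 1) (φ i) ?_ (hφ.ne_zero i) ?_ ?_ ?_
    · unfold adjMat
      rw [Matrix.IsHermitian, Matrix.conjTranspose_eq_transpose_of_trivial]
      let _ := Classical.decRel G.Adj
      exact G.isSymm_adjMatrix
    · intro h
      have := congrFun h ⟨0, hn⟩
      simp at this
    · rw [hA]; funext v; simp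
    · rw [hA]; funext v; simp [hφl]
    · intro f m hf hm
      rw [hA] at hf
      exact h1 f m (fun v => by simpa using congrFun hf v) hm
  · unfold eigMult
    have hm : ∀ i, φ i ∈ Module.End.eigenspace (Matrix.mulVecLin (adjMat G)) (l : ℝ) := by
      intro i
      rw [Module.End.mem_eigenspace_iff, Matrix.mulVecLin_apply, hA]
      funext v
      simp [hφl]
    have : LinearIndependent ℝ (fun i => (⟨φ i, hm i⟩ : Module.End.eigenspace (Matrix.mulVecLin (adjMat G)) (l : ℝ))) := by
      apply LinearIndependent.of_comp (Submodule.subtype _)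
      exact hφ
    exact this.fintype_card_le_finrank

section alg
variable {A : Type*} [Ring A] [Algebra ℝ A]

/-- average of a family. -/
noncomputable def avg {ι : Type*} [Fintype ι] (X : ι → A) : A :=
  ((Fintype.card ι : ℝ)⁻¹) • ∑ a, X a

lemma avg_absorb {ι : Type*} [Fintype ι] [AddCommGroup ι] (X : ι → A)
    (hX : ∀ a b, X (a + b) = X a * X b) (a : ι) : X a * avg X = avg X := by
  unfold avg
  rw [mul_smul_comm, Finset.mul_sum]
  congr 1
  simp_rw [← hX]
  exact Fintype.sum_equiv (Equiv.addLeft a) _ _ (fun _ => rfl)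

lemma avg_mul_avg_of {ι : Type*} [Fintype ι] [Nonempty ι] (X : ι → A) (B : A)
    (h : ∀ a, X a * B = B) : avg X * B = B := by
  unfold avg
  rw [smul_mul_assoc, Finset.sum_mul]
  simp_rw [h]
  rw [Finset.sum_const, Finset.card_univ, ← Nat.cast_smul_eq_nsmul ℝ, smul_smul, inv_mul_cancel₀, one_smul]
  exact_mod_cast Fintype.card_ne_zero

lemma avg_idem {ι : Type*} [Fintype ι] [AddCommGroup ι] (X : ι → A)
    (hX : ∀ a b, X (a + b) = X a * X b) : avg X * avg X = avg X :=
  avg_mul_avg_of X _ (avg_absorb X hX)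

lemma commute_avg {ι : Type*} [Fintype ι] (X : ι → A) (B : A) (h : ∀ a, Commute (X a) B) :
    Commute (avg X) B := by
  unfold avg
  exact (Commute.sum_left _ _ _ (fun a _ => h a)).smul_left _

variable {p : ℕ} [Fact p.Prime] (X Y Z : ZMod p → A)

lemma avg_comm3 (hZ : ∀ a b, Z (a + b) = Z a * Z b)
    (hXY : ∀ a b, X a * Y b = Y b * X a * Z (a * b)) (hXZ : ∀ a b, Commute (X a) (Z b))
    (hYZ : ∀ a b, Commute (Y a) (Z b)) :
    avg Z * avg X * avg Y = avg Z * avg Y * avg X := by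
  have key : ∀ a b, avg Z * (X a * Y b) = avg Z * (Y b * X a) := by
    intro a b
    have h1 : Y b * X a * Z (a * b) = Z (a * b) * (Y b * X a) := by
      rw [mul_assoc, (hXZ a _).eq, ← mul_assoc, (hYZ b _).eq, mul_assoc]
    have h2 : avg Z * Z (a * b) = avg Z := by
      rw [(commute_avg Z (Z (a * b)) (fun c => by
        rw [Commute, SemiconjBy, ← hZ, ← hZ, add_comm])).eq]
      exact avg_absorb Z hZ _
    rw [hXY, h1, ← mul_assoc, h2]
  rw [mul_assoc, mul_assoc]
  have e1 : avg X * avg Y = ((Fintype.card (ZMod p) : ℝ)⁻¹ * (Fintype.card (ZMod p) : ℝ)⁻¹) •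
      ∑ a, ∑ b, X a * Y b := by
    unfold avg
    rw [smul_mul_smul_comm, Finset.sum_mul_sum]
  have e2 : avg Y * avg X = ((Fintype.card (ZMod p) : ℝ)⁻¹ * (Fintype.card (ZMod p) : ℝ)⁻¹) •
      ∑ a, ∑ b, Y b * X a := by
    unfold avg
    rw [smul_mul_smul_comm, Finset.sum_mul_sum, Finset.sum_comm]
  rw [e1, e2, mul_smul_comm, mul_smul_comm]
  simp_rw [Finset.mul_sum, key]

lemma avg_PRP (hX : ∀ a b, X (a + b) = X a * X b) (hY0 : Y 0 = 1)
    (hZ : ∀ a b, Z (a + b) = Z a * Z b) (hZ0 : Z 0 = 1)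
    (hXY : ∀ a b, X a * Y b = Y b * X a * Z (a * b)) (hXZ : ∀ a b, Commute (X a) (Z b))
    (hYZ : ∀ a b, Commute (Y a) (Z b)) :
    avg X * avg Y * avg X - avg Z * (avg X * avg Y * avg X)
      = ((p : ℝ)⁻¹) • (avg X - avg Z * avg X) := by
  have hPZ : ∀ b, Commute (avg X) (Z b) := fun b => commute_avg X _ (fun a => hXZ a b)
  have hPZ' : Commute (avg X) (avg Z) := by
    refine (commute_avg Z _ (fun b => (hPZ b).symm)).symm
  have key : ∀ b, b ≠ 0 → avg Z * (avg X * Y b * avg X) = avg X * Y b * avg X := by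
    intro b hb
    have h1 : avg X * Y b * avg X = avg X * Y b * avg Z := by
      have h2 : ∀ a, avg X * (Y b * X a) = avg X * Y b * Z (-(a * b)) := by
        intro a
        have h3 : Y b * X a = X a * Y b * Z (-(a*b)) := by
          rw [hXY, mul_assoc, ← hZ]
          simp [hZ0]
        have h4 : avg X * X a = avg X := by
          rw [(commute_avg X (X a) (fun c => by
            rw [Commute, SemiconjBy, ← hX, ← hX, add_comm])).eq]
          exact avg_absorb X hX _
        rw [h3, mul_assoc, ← mul_assoc (avg X), h4, mul_assoc]
      have h5 : avg X * Y b * avg X = avg X * Y b * ((Fintype.card (ZMod p) : ℝ)⁻¹ • ∑ a, Z (-(a * b))) := by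
        conv_lhs => enter [2]; unfold avg
        rw [mul_smul_comm, mul_smul_comm, Finset.mul_sum, Finset.mul_sum]
        simp_rw [mul_assoc (avg X) (Y b) (X _), h2]
      rw [h5]
      congr 1
      unfold avg
      congr 1
      refine Fintype.sum_equiv ((Equiv.mulRight₀ b hb).trans (Equiv.neg _)) _ _ (fun a => ?_)
      simp
    rw [h1]
    have hYP : Commute (Y b) (avg Z) := (commute_avg Z _ (fun c => (hYZ b c).symm)).symm
    rw [mul_assoc (avg X), hYP.eq, ← mul_assoc (avg X), hPZ'.eq, mul_assoc (avg Z) (avg X),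
      ← mul_assoc (avg Z) (avg Z), avg_idem Z hZ]
  have hsum : avg X * avg Y * avg X = (p : ℝ)⁻¹ • ∑ b, avg X * Y b * avg X := by
    conv_lhs => enter [1, 2]; unfold avg
    rw [mul_smul_comm, smul_mul_assoc, Finset.mul_sum, Finset.sum_mul, ZMod.card]
  rw [hsum, mul_smul_comm, ← smul_sub]
  congr 1
  rw [Finset.mul_sum, ← Finset.sum_sub_distrib, Finset.sum_eq_single 0]
  · rw [hY0, mul_one, avg_idem X hX]
  · intro b _ hb
    rw [key b hb, sub_self]
  · simp

end alg

lemma sq_form_bound (a b s N : ℝ) (ha : 0 ≤ a) (hb : 0 ≤ b)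
    (hs : s ^ 2 ≤ (a / 37) * b) (hcs : (a + b) ^ 2 ≤ (a + b + 2 * s) * N) (hN : 0 ≤ N)
    (hT : 0 ≤ 49 / 36 * N - 7 / 3 * (a + b) + (a + b + 2 * s)) :
    0 ≤ 2 * (N - a - b + s) + 1 / 6 * ((N - a) + (N - b)) := by
  have hs' : s ≤ (a + b) / 12 := by
    have h1 : s ^ 2 ≤ ((a + b) / 12) ^ 2 := by nlinarith [sq_nonneg (a - b), mul_nonneg ha hb]
    exact le_of_sq_le_sq h1 (by positivity)
  have h2 : a + b ≤ 7 / 6 * N := by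
    rcases eq_or_lt_of_le (add_nonneg ha hb) with h | h
    · rw [← h]; positivity
    · have : (a + b) * (a + b) ≤ (a + b) * (7 / 6 * N) := by nlinarith
      exact le_of_mul_le_mul_left this h
  nlinarith

section hilb
variable {E : Type*} [NormedAddCommGroup E] [InnerProductSpace ℝ E]

local notation "⟪" x "," y "⟫" => inner ℝ x y

lemma pair_v (P R : E →ₗ[ℝ] E) (hP : P.IsSymmetric) (hR : R.IsSymmetric)
    (hPP : ∀ f, P (P f) = P f) (hRR : ∀ f, R (R f) = R f) (v : E)
    (hPRP : P (R (P v)) = (37 : ℝ)⁻¹ • P v) :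
    0 ≤ 2 * ⟪v - P v, v - R v⟫ + 1 / 6 * (⟪v - P v, v - P v⟫ + ⟪v - R v, v - R v⟫) := by
  have ea : ⟪P v, v⟫ = ⟪P v, P v⟫ := by rw [← hP, hPP]
  have eb : ⟪R v, v⟫ = ⟪R v, R v⟫ := by rw [← hR, hRR]
  have ea' : ⟪v, P v⟫ = ⟪P v, P v⟫ := by rw [real_inner_comm, ea]
  have eb' : ⟪v, R v⟫ = ⟪R v, R v⟫ := by rw [real_inner_comm, eb]
  have es : ⟪R v, P v⟫ = ⟪P v, R v⟫ := real_inner_comm _ _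
  have h := sq_form_bound ⟪P v, P v⟫ ⟪R v, R v⟫ ⟪P v, R v⟫ ⟪v, v⟫ real_inner_self_nonneg
    real_inner_self_nonneg ?_ ?_ real_inner_self_nonneg ?_
  · simp only [inner_sub_left, inner_sub_right, ea, eb, ea', eb']
    linarith
  · have h1 : ⟪P v, R v⟫ = ⟪R (P v), R v⟫ := by rw [hR (P v), hRR]
    have h2 : ⟪R (P v), R (P v)⟫ = ⟪P v, P v⟫ / 37 := by
      rw [hR, hRR, hP, hPRP, inner_smul_right, ea']
      ring
    rw [h1, sq, ← h2]
    exact real_inner_mul_inner_self_le _ _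
  · have h1 := real_inner_mul_inner_self_le (P v + R v) v
    simp only [inner_add_left, inner_add_right, ea, eb, es] at h1
    nlinarith
  · have h1 : 0 ≤ ⟪(7 / 6 : ℝ) • v - (P v + R v), (7 / 6 : ℝ) • v - (P v + R v)⟫ := real_inner_self_nonneg
    simp only [inner_sub_left, inner_sub_right, inner_add_left, inner_add_right, inner_smul_left,
      inner_smul_right, ea, eb, es, ea', eb'] at h1
    simp only [RCLike.conj_to_real] at h1
    linarith

lemma comm_nonneg (P R : E →ₗ[ℝ] E) (hP : P.IsSymmetric) (hR : R.IsSymmetric)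
    (hPP : ∀ f, P (P f) = P f) (hRR : ∀ f, R (R f) = R f) (u : E)
    (h : P (R u) = R (P u)) : 0 ≤ ⟪u - P u, u - R u⟫ := by
  have h1 : 0 ≤ ⟪u - P u - R u + P (R u), u - P u - R u + P (R u)⟫ := real_inner_self_nonneg
  have ea' : ⟪P u, u⟫ = ⟪P u, P u⟫ := by rw [← hP, hPP]
  have eb' : ⟪R u, u⟫ = ⟪R u, R u⟫ := by rw [← hR, hRR]
  have ea : ⟪u, P u⟫ = ⟪P u, P u⟫ := by rw [real_inner_comm, ea']
  have eb : ⟪u, R u⟫ = ⟪R u, R u⟫ := by rw [real_inner_comm, eb']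
  have es : ⟪R u, P u⟫ = ⟪P u, R u⟫ := real_inner_comm _ _
  have e1 : ⟪u, P (R u)⟫ = ⟪P u, R u⟫ := by rw [hP]
  have e2 : ⟪P u, P (R u)⟫ = ⟪P u, R u⟫ := by rw [← hP, hPP]
  have e3 : ⟪R u, P (R u)⟫ = ⟪P u, R u⟫ := by rw [h, ← hR, hRR, es]
  have e4 : ⟪P (R u), P (R u)⟫ = ⟪P u, R u⟫ := by rw [hP, hPP, e3]
  have e1' : ⟪P (R u), u⟫ = ⟪P u, R u⟫ := by rw [real_inner_comm, e1]
  have e2' : ⟪P (R u), P u⟫ = ⟪P u, R u⟫ := by rw [real_inner_comm, e2]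
  have e3' : ⟪P (R u), R u⟫ = ⟪P u, R u⟫ := by rw [real_inner_comm, e3]
  simp only [inner_sub_left, inner_sub_right, inner_add_left, inner_add_right, ea, eb, ea', eb', es,
    e1, e2, e3, e4, e1', e2', e3'] at h1 ⊢
  linarith

lemma pair_ineq (P R Z : E →ₗ[ℝ] E) (hP : P.IsSymmetric) (hR : R.IsSymmetric) (hZ : Z.IsSymmetric)
    (hPP : ∀ f, P (P f) = P f) (hRR : ∀ f, R (R f) = R f) (hZZ : ∀ f, Z (Z f) = Z f)
    (hPZ : ∀ f, P (Z f) = Z (P f)) (hRZ : ∀ f, R (Z f) = Z (R f))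
    (hc : ∀ f, Z (P (R f)) = Z (R (P f)))
    (hPRP : ∀ f, P (R (P f)) - Z (P (R (P f))) = (37 : ℝ)⁻¹ • (P f - Z (P f))) (f : E) :
    0 ≤ 2 * ⟪f - P f, f - R f⟫ + 1 / 6 * (⟪f - P f, f - P f⟫ + ⟪f - R f, f - R f⟫) := by
  have hu := comm_nonneg P R hP hR hPP hRR (Z f) (by rw [hRZ, hPZ, hPZ, hRZ, hc])
  have hv := pair_v P R hP hR hPP hRR (f - Z f) (by
    simp only [map_sub, hPZ, hRZ]
    exact hPRP f)
  have horth : ∀ a b, ⟪Z a, b - Z b⟫ = 0 := by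
    intro a b
    rw [hZ, map_sub, hZZ, sub_self, inner_zero_right]
  have e1 : Z f - P (Z f) = Z (f - P f) := by rw [map_sub, hPZ]
  have e2 : Z f - R (Z f) = Z (f - R f) := by rw [map_sub, hRZ]
  have e3 : (f - Z f) - P (f - Z f) = (f - P f) - Z (f - P f) := by
    simp only [map_sub, hPZ]; abel
  have e4 : (f - Z f) - R (f - Z f) = (f - R f) - Z (f - R f) := by
    simp only [map_sub, hRZ]; abel
  rw [e1, e2] at hu
  rw [e3, e4] at hv
  generalize f - P f = a at *
  generalize f - R f = b at *
  have split : ∀ a b, ⟪a, b⟫ = ⟪Z a, Z b⟫ + ⟪a - Z a, b - Z b⟫ := by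
    intro a b
    have h1 := horth a b
    have h2 := horth b a
    rw [real_inner_comm] at h2
    simp only [inner_sub_left, inner_sub_right] at h1 h2 ⊢
    linarith
  rw [split a b, split a a, split b b]
  have n1 : 0 ≤ ⟪Z a, Z a⟫ := real_inner_self_nonneg
  have n2 : 0 ≤ ⟪Z b, Z b⟫ := real_inner_self_nonneg
  linarith

/-- spectral gap from the operator inequality -/
lemma gap_of_sq [FiniteDimensional ℝ E] (D : E →ₗ[ℝ] E) (hD : D.IsSymmetric) (g : ℝ) (hg : 0 < g)
    (hpos : ∀ f, 0 ≤ ⟪D f, f⟫) (hsq : ∀ f, g * ⟪D f, f⟫ ≤ ⟪D f, D f⟫) (f : E)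
    (hf : ∀ k, D k = 0 → ⟪k, f⟫ = 0) : g * ⟪f, f⟫ ≤ ⟪D f, f⟫ := by
  have hmem : f ∈ LinearMap.range D := by
    have h1 : f ∈ (LinearMap.ker D)ᗮ := by
      rw [Submodule.mem_orthogonal]
      intro u hu
      exact hf u (by simpa using hu)
    rw [← hD.orthogonal_range, Submodule.orthogonal_orthogonal] at h1
    exact h1
  obtain ⟨h, rfl⟩ := hmem
  set f := D h with hfdef
  -- Cauchy-Schwarz for the positive form
  have cs : ⟪D h, f⟫ ^ 2 ≤ ⟪D h, h⟫ * ⟪D f, f⟫ := by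
    have hq : ∀ t : ℝ, 0 ≤ ⟪D f, f⟫ * (t * t) + (2 * ⟪D h, f⟫) * t + ⟪D h, h⟫ := by
      intro t
      have h1 := hpos (h + t • f)
      have h2 : ⟪D f, h⟫ = ⟪D h, f⟫ := by rw [hD, real_inner_comm]
      simp only [map_add, map_smul, inner_add_left, inner_add_right, inner_smul_left,
        inner_smul_right, h2] at h1
      simp at h1
      linarith
    have := discrim_le_zero hq
    unfold discrim at this
    nlinarith
  have h1 := hsq h
  rw [← hfdef] at cs h1
  have h3 := hpos f
  rcases eq_or_lt_of_le (real_inner_self_nonneg (x := f) (F := E)) with h0 | h0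
  · rw [← h0]; simpa using h3
  · have : ⟪f, f⟫ * (g * ⟪f, f⟫) ≤ ⟪f, f⟫ * ⟪D f, f⟫ := by
      nlinarith
    exact le_of_mul_le_mul_left this h0

lemma four_ineq (P : Fin 3 → E →ₗ[ℝ] E) (P4 : E →ₗ[ℝ] E) (hP : ∀ i, (P i).IsSymmetric)
    (hP4 : P4.IsSymmetric) (hPP : ∀ i f, P i (P i f) = P i f) (hPP4 : ∀ f, P4 (P4 f) = P4 f)
    (hcomm : ∀ i f, P i (P4 f) = P4 (P i f))
    (hpair : ∀ i f, 0 ≤ 2 * ⟪f - P i f, f - P (i + 1) f⟫ + 1 / 6 * (⟪f - P i f, f - P i f⟫ +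
      ⟪f - P (i + 1) f, f - P (i + 1) f⟫)) (r : ℝ) (hr : 20 ≤ r)
    (D : E →ₗ[ℝ] E) (hD : ∀ f, D f = (37 : ℝ) • (∑ i, (f - P i f)) + r • (f - P4 f)) :
    D.IsSymmetric ∧ (∀ f, 0 ≤ ⟪D f, f⟫) ∧ (∀ f, 20 * ⟪D f, f⟫ ≤ ⟪D f, D f⟫) ∧
    (∀ f, D f = 0 → (∀ i, P i f = f) ∧ P4 f = f) := by
  have hq : ∀ i f, ⟪f - P i f, f⟫ = ⟪f - P i f, f - P i f⟫ := by
    intro i f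
    rw [inner_sub_right (f - P i f) f (P i f)]
    rw [← hP, map_sub, hPP, sub_self, inner_zero_left, sub_zero]
  have hq4 : ∀ f, ⟪f - P4 f, f⟫ = ⟪f - P4 f, f - P4 f⟫ := by
    intro f
    rw [inner_sub_right (f - P4 f) f (P4 f)]
    rw [← hP4, map_sub, hPP4, sub_self, inner_zero_left, sub_zero]
  have hform : ∀ f, ⟪D f, f⟫ = 37 * ∑ i, ⟪f - P i f, f - P i f⟫ + r * ⟪f - P4 f, f - P4 f⟫ := by
    intro f
    rw [hD, inner_add_left, inner_smul_left, inner_smul_left, sum_inner]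
    simp_rw [hq, hq4]
    simp
  refine ⟨?_, ?_, ?_, ?_⟩
  · intro f g
    rw [hD, hD, inner_add_left, inner_add_right, inner_smul_left, inner_smul_left, inner_smul_right,
      inner_smul_right, sum_inner, inner_sum]
    congr 2
    · refine Finset.sum_congr rfl (fun i _ => ?_)
      rw [inner_sub_left, inner_sub_right, hP]
    · rw [inner_sub_left, inner_sub_right, hP4]
  · intro f
    rw [hform]
    have : 0 ≤ ∑ i, ⟪f - P i f, f - P i f⟫ := Finset.sum_nonneg (fun i _ => real_inner_self_nonneg)
    have : 0 ≤ ⟪f - P4 f, f - P4 f⟫ := real_inner_self_nonneg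
    positivity
  · intro f
    rw [hform, hD]
    have c0 := comm_nonneg (P 0) P4 (hP 0) hP4 (hPP 0) hPP4 f (hcomm 0 f)
    have c1 := comm_nonneg (P 1) P4 (hP 1) hP4 (hPP 1) hPP4 f (hcomm 1 f)
    have c2 := comm_nonneg (P 2) P4 (hP 2) hP4 (hPP 2) hPP4 f (hcomm 2 f)
    have p0 := hpair 0 f
    have p1 := hpair 1 f
    have p2 := hpair 2 f
    simp only [Fin.sum_univ_three]
    have z1 : (0 : Fin 3) + 1 = 1 := rfl
    have z2 : (1 : Fin 3) + 1 = 2 := rfl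
    have z3 : (2 : Fin 3) + 1 = 0 := rfl
    rw [z1] at p0
    rw [z2] at p1
    rw [z3] at p2
    generalize f - P 0 f = a at *
    generalize f - P 1 f = b at *
    generalize f - P 2 f = c at *
    generalize f - P4 f = e at *
    simp only [inner_add_left, inner_add_right, inner_smul_left, inner_smul_right]
    simp only [RCLike.conj_to_real]
    rw [real_inner_comm a b, real_inner_comm b c, real_inner_comm a e, real_inner_comm b e, real_inner_comm c e, real_inner_comm c a] at *
    have na : 0 ≤ ⟪a, a⟫ := real_inner_self_nonneg
    have nb : 0 ≤ ⟪b, b⟫ := real_inner_self_nonneg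
    have nc : 0 ≤ ⟪c, c⟫ := real_inner_self_nonneg
    have ne : 0 ≤ ⟪e, e⟫ := real_inner_self_nonneg
    have hr0 : 0 ≤ r := by linarith
    have := mul_nonneg hr0 c0
    have := mul_nonneg hr0 c1
    have := mul_nonneg hr0 c2
    have := mul_nonneg (mul_nonneg hr0 (sub_nonneg.2 hr)) ne
    nlinarith
  · intro f hf
    have h := hform f
    rw [hf, inner_zero_left] at h
    have n4 : 0 ≤ ⟪f - P4 f, f - P4 f⟫ := real_inner_self_nonneg
    have ns : 0 ≤ ∑ i, ⟪f - P i f, f - P i f⟫ := Finset.sum_nonneg (fun i _ => real_inner_self_nonneg)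
    have m4 : 0 ≤ r * ⟪f - P4 f, f - P4 f⟫ := by positivity
    constructor
    · have : ∑ i, ⟪f - P i f, f - P i f⟫ = 0 := by linarith
      rw [Finset.sum_eq_zero_iff_of_nonneg (fun i _ => real_inner_self_nonneg)] at this
      intro i
      have h1 := this i (Finset.mem_univ i)
      rw [inner_self_eq_zero, sub_eq_zero] at h1
      exact h1.symm
    · have : r * ⟪f - P4 f, f - P4 f⟫ = 0 := by linarith
      have h1 : ⟪f - P4 f, f - P4 f⟫ = 0 := by
        rcases mul_eq_zero.1 this with h | h
        · linarith
        · exact h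
      rw [inner_self_eq_zero, sub_eq_zero] at h1
      exact h1.symm

end hilb

section cayley
variable {Y : Type*} [Group Y]

/-- right regular representation -/
noncomputable def rho : Y →* Module.End ℝ (EuclideanSpace ℝ Y) where
  toFun g :=
    { toFun := fun f => WithLp.toLp 2 (fun y => f (y * g))
      map_add' := fun f h => by ext y; simp
      map_smul' := fun c f => by ext y; simp }
  map_one' := by ext f y; simp
  map_mul' g h := by ext f y; simp [mul_assoc]

lemma rho_apply (g : Y) (f : EuclideanSpace ℝ Y) (y : Y) : rho g f y = f (y * g) := rfl

variable [Fintype Y]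

lemma rho_inner (g : Y) (f h : EuclideanSpace ℝ Y) :
    inner ℝ (rho g f) h = inner ℝ f (rho g⁻¹ h) := by
  rw [PiLp.inner_apply, PiLp.inner_apply]
  simp only [rho_apply]
  refine Fintype.sum_equiv (Equiv.mulRight g) _ _ (fun y => ?_)
  simp

lemma avg_rho_symm {ι : Type*} [Fintype ι] [AddCommGroup ι] (x : ι → Y)
    (hx : ∀ a b, x (a + b) = x a * x b) : (avg (fun a => rho (x a))).IsSymmetric := by
  have hneg : ∀ a, (x a)⁻¹ = x (-a) := by
    intro a
    have h0 : x 0 = 1 := by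
      have := hx 0 0
      simpa using this
    rw [inv_eq_iff_mul_eq_one, ← hx]
    simp [h0]
  intro f h
  unfold avg
  simp only [LinearMap.smul_apply, LinearMap.sum_apply, inner_smul_left, inner_smul_right, sum_inner,
    inner_sum, RCLike.conj_to_real]
  congr 1
  refine Fintype.sum_equiv (Equiv.neg ι) _ _ (fun a => ?_)
  rw [rho_inner, hneg]
  rfl

lemma cayley_gap {p : ℕ} [Fact p.Prime] (hp : p = 37) (x z : Fin 3 → ZMod p → Y) (r : ℕ) [NeZero r] (hr : 20 ≤ r) (x4 : ZMod r → Y)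
    (hx : ∀ i a b, x i (a + b) = x i a * x i b) (hz : ∀ i a b, z i (a + b) = z i a * z i b)
    (hx4 : ∀ a b, x4 (a + b) = x4 a * x4 b)
    (hxy : ∀ i a b, x i a * x (i + 1) b = x (i + 1) b * x i a * z i (a * b))
    (hxz : ∀ i a b, Commute (x i a) (z i b)) (hxz' : ∀ i a b, Commute (x (i + 1) a) (z i b))
    (h4 : ∀ i a b, Commute (x i a) (x4 b))
    (hgen : ∀ S : Subgroup Y, (∀ i a, x i a ∈ S) → (∀ b, x4 b ∈ S) → S = ⊤) (f : Y → ℝ) :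
    ∑ y, f y * (∑ i, ∑ a, f (y * x i a) + ∑ b, f (y * x4 b)) ≤
      (111 + r) * ∑ y, f y ^ 2 - 20 * ∑ y, (f y - (∑ y', f y') / Fintype.card Y) ^ 2 := by
  classical
  have e37 : (p : ℝ) = (37 : ℝ) := by rw [hp]; norm_num
  have hx0 : ∀ i, x i 0 = 1 := fun i => by simpa using hx i 0 0
  have hz0 : ∀ i, z i 0 = 1 := fun i => by simpa using hz i 0 0
  let P : Fin 3 → Module.End ℝ (EuclideanSpace ℝ Y) := fun i => avg (fun a => rho (x i a))
  let Z : Fin 3 → Module.End ℝ (EuclideanSpace ℝ Y) := fun i => avg (fun a => rho (z i a))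
  let P4 : Module.End ℝ (EuclideanSpace ℝ Y) := avg (fun a => rho (x4 a))
  let D : Module.End ℝ (EuclideanSpace ℝ Y) := (37 : ℝ) • (∑ i, (1 - P i)) + (r : ℝ) • (1 - P4)
  have hrx : ∀ i a b, rho (x i (a + b)) = rho (x i a) * rho (x i b) := fun i a b => by
    rw [hx, map_mul]
  have hrz : ∀ i a b, rho (z i (a + b)) = rho (z i a) * rho (z i b) := fun i a b => by
    rw [hz, map_mul]
  have hrx4 : ∀ a b, rho (x4 (a + b)) = rho (x4 a) * rho (x4 b) := fun a b => by
    rw [hx4, map_mul]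
  have hrxy : ∀ i a b, rho (x i a) * rho (x (i + 1) b) = rho (x (i + 1) b) * rho (x i a) * rho (z i (a * b)) :=
    fun i a b => by rw [← map_mul, hxy, map_mul, map_mul]
  have hrxz : ∀ i a b, Commute (rho (x i a)) (rho (z i b)) := fun i a b => (hxz i a b).map rho
  have hrxz' : ∀ i a b, Commute (rho (x (i + 1) a)) (rho (z i b)) := fun i a b => (hxz' i a b).map rho
  have hr4 : ∀ i a b, Commute (rho (x i a)) (rho (x4 b)) := fun i a b => (h4 i a b).map rho
  have hPs : ∀ i, (P i).IsSymmetric := fun i => avg_rho_symm (x i) (hx i)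
  have hPi : ∀ i f, P i (P i f) = P i f := fun i f =>
    LinearMap.congr_fun (avg_idem (fun a => rho (x i a)) (hrx i)) f
  have hZi : ∀ i f, Z i (Z i f) = Z i f := fun i f =>
    LinearMap.congr_fun (avg_idem (fun a => rho (z i a)) (hrz i)) f
  have hP4i : ∀ f, P4 (P4 f) = P4 f := fun f =>
    LinearMap.congr_fun (avg_idem (fun a => rho (x4 a)) hrx4) f
  have hPZ : ∀ i f, P i (Z i f) = Z i (P i f) := fun i f =>
    LinearMap.congr_fun (commute_avg _ _ (fun a => (commute_avg _ _ (fun b => (hrxz i a b).symm)).symm)).eq f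
  have hPZ' : ∀ i f, P (i + 1) (Z i f) = Z i (P (i + 1) f) := fun i f =>
    LinearMap.congr_fun (commute_avg _ _ (fun a => (commute_avg _ _ (fun b => (hrxz' i a b).symm)).symm)).eq f
  have hPP4 : ∀ i f, P i (P4 f) = P4 (P i f) := fun i f =>
    LinearMap.congr_fun (commute_avg _ _ (fun a => (commute_avg _ _ (fun b => (hr4 i a b).symm)).symm)).eq f
  have hpair : ∀ i f, 0 ≤ 2 * inner ℝ (f - P i f) (f - P (i + 1) f) + 1 / 6 * (inner ℝ (f - P i f) (f - P i f) +
      inner ℝ (f - P (i + 1) f) (f - P (i + 1) f)) := by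
    intro i f
    refine pair_ineq (P i) (P (i + 1)) (Z i) (hPs i) (hPs _) (avg_rho_symm (z i) (hz i)) (hPi i) (hPi _)
      (hZi i) (hPZ i) (hPZ' i) ?_ ?_ f
    · intro f
      exact LinearMap.congr_fun (avg_comm3 (fun a => rho (x i a)) (fun a => rho (x (i + 1) a))
        (fun a => rho (z i a)) (hrz i) (hrxy i) (hrxz i) (hrxz' i)) f
    · intro f
      have := LinearMap.congr_fun (avg_PRP (fun a => rho (x i a)) (fun a => rho (x (i + 1) a))
        (fun a => rho (z i a)) (hrx i) (by rw [hx0, map_one]) (hrz i) (by rw [hz0, map_one])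
        (hrxy i) (hrxz i) (hrxz' i)) f
      rw [e37] at this
      exact this
  have hDf : ∀ f, D f = (37 : ℝ) • (∑ i, (f - P i f)) + (r : ℝ) • (f - P4 f) := by
    intro f
    simp [D, LinearMap.sum_apply]
  obtain ⟨hDs, hDp, hDq, hDk⟩ := four_ineq P P4 hPs (avg_rho_symm x4 hx4) hPi hP4i hPP4 hpair (r : ℝ)
    (by exact_mod_cast hr) D hDf
  have hDval : ∀ (f : EuclideanSpace ℝ Y) y, D f y = (111 + r) * f y -
      (∑ i, ∑ a, f (y * x i a) + ∑ b, f (y * x4 b)) := by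
    intro f y
    have hr0 : (r : ℝ) ≠ 0 := by exact_mod_cast NeZero.ne r
    rw [hDf]
    simp [P, P4, avg, LinearMap.sum_apply, rho_apply, Fin.sum_univ_three, ZMod.card, e37]
    field_simp
    ring
  -- invariance of the kernel
  have hker : ∀ k, D k = 0 → ∀ y y', k y = k y' := by
    intro k hk
    obtain ⟨h1, h2⟩ := hDk k hk
    have i1 : ∀ i a, rho (x i a) k = k := by
      intro i a
      have := LinearMap.congr_fun (avg_absorb (fun a => rho (x i a)) (hrx i) a) k
      change rho (x i a) (P i k) = P i k at this
      rwa [h1 i] at this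
    have i2 : ∀ a, rho (x4 a) k = k := by
      intro a
      have := LinearMap.congr_fun (avg_absorb (fun a => rho (x4 a)) hrx4 a) k
      change rho (x4 a) (P4 k) = P4 k at this
      rwa [h2] at this
    let S : Subgroup Y :=
      { carrier := {g | rho g k = k}
        mul_mem' := by
          intro a b ha hb
          simp only [Set.mem_ofPred_eq] at *
          rw [map_mul, Module.End.mul_apply, hb, ha]
        one_mem' := by simp
        inv_mem' := by
          intro a ha
          simp only [Set.mem_ofPred_eq] at *
          conv_lhs => rw [← ha]
          rw [← Module.End.mul_apply, ← map_mul]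
          simp }
    have hS := hgen S i1 i2
    intro y y'
    have : y⁻¹ * y' ∈ S := by rw [hS]; trivial
    have h3 : rho (y⁻¹ * y') k = k := this
    have h4 := congrArg (fun h : EuclideanSpace ℝ Y => h y) h3
    simp only [rho_apply] at h4
    rw [← h4]
    simp
  set c := (∑ y', f y') / Fintype.card Y with hc
  have hcard : (Fintype.card Y : ℝ) ≠ 0 := by exact_mod_cast Fintype.card_ne_zero
  let F : EuclideanSpace ℝ Y := WithLp.toLp 2 f
  let H : EuclideanSpace ℝ Y := WithLp.toLp 2 (fun y => f y - c)
  have hHsum : ∑ y, H y = 0 := by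
    simp [H, Finset.sum_sub_distrib, hc]
    field_simp
    simp
  have hgap := gap_of_sq D hDs 20 (by norm_num) hDp hDq H (by
    intro k hk
    rw [PiLp.inner_apply]
    have hk' := hker k hk
    have : ∀ y, inner ℝ (k y) (H y) = k 1 * H y := by
      intro y; rw [hk' y 1]; simp [mul_comm]
    simp_rw [this]
    rw [← Finset.mul_sum, hHsum, mul_zero])
  have hDH : D H = D F := by
    ext y
    rw [hDval, hDval]
    have hr0 : (r : ℝ) ≠ 0 := by exact_mod_cast NeZero.ne r
    simp [H, F, Finset.sum_sub_distrib, Fin.sum_univ_three, ZMod.card, e37]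
    ring
  have hDFsum : ∑ y, D F y = 0 := by
    have h1 : ∑ y, D F y = inner ℝ (D F) (WithLp.toLp 2 (fun _ => (1 : ℝ))) := by
      rw [PiLp.inner_apply]; simp
    rw [h1, hDs]
    have : D (WithLp.toLp 2 (fun _ => (1 : ℝ))) = 0 := by
      ext y
      rw [hDval]
      simp [Fin.sum_univ_three, ZMod.card, e37]
      ring
    rw [this, inner_zero_right]
  have hDHH : inner ℝ (D H) H = ∑ y, f y * D F y := by
    rw [hDH, PiLp.inner_apply]
    have : ∀ y, inner ℝ (D F y) (H y) = f y * D F y - c * D F y := by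
      intro y; simp [H]; ring
    simp_rw [this]
    rw [Finset.sum_sub_distrib, ← Finset.mul_sum, hDFsum]
    simp
  have hHH : inner ℝ H H = ∑ y, (f y - c) ^ 2 := by
    rw [PiLp.inner_apply]
    refine Finset.sum_congr rfl (fun y _ => ?_)
    simp [H, sq]
  rw [hDHH, hHH] at hgap
  have hfin : ∑ y, f y * D F y = (111 + r) * ∑ y, f y ^ 2 -
      ∑ y, f y * (∑ i, ∑ a, f (y * x i a) + ∑ b, f (y * x4 b)) := by
    rw [Finset.mul_sum, ← Finset.sum_sub_distrib]
    refine Finset.sum_congr rfl (fun y _ => ?_)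
    rw [hDval]
    simp only [F]
    ring
  linarith

end cayley

section slgroup
variable {R : Type*} [Field R]

/-- elementary matrix -/
def Tv (i j : Fin 3) (h : i ≠ j) (c : R) : Matrix.SpecialLinearGroup (Fin 3) R :=
  ⟨Matrix.transvection i j c, Matrix.det_transvection_of_ne i j h c⟩

lemma Tv_coe (i j : Fin 3) (h : i ≠ j) (c : R) :
    (Tv i j h c).1 = Matrix.transvection i j c := rfl

lemma Tv_add (i j : Fin 3) (h : i ≠ j) (a b : R) : Tv i j h (a + b) = Tv i j h a * Tv i j h b := by
  apply Subtype.ext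
  simp only [Matrix.SpecialLinearGroup.coe_mul, Tv_coe]
  simp [Tv, Matrix.transvection_mul_transvection_same i j h]

lemma Tv_comm (i j k : Fin 3) (hij : i ≠ j) (hjk : j ≠ k) (hik : i ≠ k) (a b : R) :
    Tv i j hij a * Tv j k hjk b = Tv j k hjk b * Tv i j hij a * Tv i k hik (a * b) := by
  apply Subtype.ext
  simp only [Matrix.SpecialLinearGroup.coe_mul, Tv_coe]
  simp [Tv, Matrix.transvection, mul_add, add_mul, Matrix.single_mul_single_of_ne, hij.symm, hik.symm, hjk.symm]
  abel

lemma Tv_commute1 (i j k : Fin 3) (hij : i ≠ j) (hik : i ≠ k) (a b : R) :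
    Commute (Tv i j hij a) (Tv i k hik b) := by
  show _ * _ = _ * _
  apply Subtype.ext
  simp only [Matrix.SpecialLinearGroup.coe_mul, Tv_coe]
  simp [Tv, Matrix.transvection, mul_add, add_mul, Matrix.single_mul_single_of_ne, hij.symm, hik.symm]
  abel

lemma Tv_commute2 (i j k : Fin 3) (hjk : j ≠ k) (hik : i ≠ k) (a b : R) :
    Commute (Tv j k hjk a) (Tv i k hik b) := by
  show _ * _ = _ * _
  apply Subtype.ext
  simp only [Matrix.SpecialLinearGroup.coe_mul, Tv_coe]
  simp [Tv, Matrix.transvection, mul_add, add_mul, Matrix.single_mul_single_of_ne, hik.symm, hjk.symm]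
  abel

lemma Tv_entry (i j : Fin 3) (h : i ≠ j) (c : R) : (Tv i j h c).1 i j = c := by
  simp [Tv, Matrix.transvection, h]

lemma Tv_entry' (i j k l : Fin 3) (h : i ≠ j) (hkl : k ≠ l) (hik : i ≠ k) (c : R) :
    (Tv i j h c).1 k l = 0 := by
  simp [Tv, Matrix.transvection, hkl, hik]

lemma Tv_zero (i j : Fin 3) (h : i ≠ j) : Tv i j h (0 : R) = 1 := by
  apply Subtype.ext
  simp [Tv]

end slgroup

lemma succ_ne3 (i : Fin 3) : i ≠ i + 1 := by revert i; decide
lemma succ_ne3' (i : Fin 3) : i ≠ i + 1 + 1 := by revert i; decide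

lemma closure_gen {G : Type*} [Group G] (T : Set G) (S : Subgroup (Subgroup.closure T))
    (h : ∀ g (hg : g ∈ T), (⟨g, Subgroup.subset_closure hg⟩ : Subgroup.closure T) ∈ S) : S = ⊤ := by
  rw [eq_top_iff]
  rintro ⟨g, hg⟩ -
  induction hg using Subgroup.closure_induction with
  | mem g hg => exact h g hg
  | one => exact S.one_mem
  | mul a b ha hb iha ihb => exact S.mul_mem iha ihb
  | inv a ha iha => exact S.inv_mem iha

/-- The family of finite groups. -/
lemma groups_exist_aux {p : ℕ} [Fact p.Prime] (m : ℕ) (R : Type) [Field R] [Finite R]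
    (hRcard : Nat.card R = p ^ m) (φ : ZMod p →+* R) :
    ∃ (Γ : Type) (_ : Group Γ) (_ : Fintype Γ) (x z : Fin 3 → ZMod p → Γ),
      (∀ i a b, x i (a + b) = x i a * x i b) ∧ (∀ i a b, z i (a + b) = z i a * z i b) ∧
      (∀ i a b, x i a * x (i + 1) b = x (i + 1) b * x i a * z i (a * b)) ∧
      (∀ i a b, Commute (x i a) (z i b)) ∧ (∀ i a b, Commute (x (i + 1) a) (z i b)) ∧
      (∀ S : Subgroup Γ, (∀ i a, x i a ∈ S) → S = ⊤) ∧
      (∀ i j a b, a ≠ 0 → x i a = x j b → i = j ∧ a = b) ∧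
      p ^ m ∣ Fintype.card Γ ∧ Fintype.card Γ ≤ p ^ (9 * m) := by
  classical
  obtain ⟨t, ht⟩ := IsCyclic.exists_generator (α := Rˣ)
  have hφ : Function.Injective φ := φ.injective
  let w : Fin 3 → R := ![1, 1, (t : R)]
  have hw : ∀ i, w i ≠ 0 := by
    intro i; fin_cases i <;> simp [w]
  let x0 : Fin 3 → ZMod p → Matrix.SpecialLinearGroup (Fin 3) R :=
    fun i a => Tv i (i + 1) (succ_ne3 i) (w i * φ a)
  let z0 : Fin 3 → ZMod p → Matrix.SpecialLinearGroup (Fin 3) R :=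
    fun i a => Tv i (i + 1 + 1) (succ_ne3' i) (w i * w (i + 1) * φ a)
  let Γ := Subgroup.closure {g | ∃ i a, g = x0 i a}
  have hxm : ∀ i a, x0 i a ∈ Γ := fun i a => Subgroup.subset_closure ⟨i, a, rfl⟩
  have hxy0 : ∀ i a b, x0 i a * x0 (i + 1) b = x0 (i + 1) b * x0 i a * z0 i (a * b) := by
    intro i a b
    have := Tv_comm i (i + 1) (i + 1 + 1) (succ_ne3 i) (succ_ne3 _) (succ_ne3' i) (w i * φ a) (w (i + 1) * φ b)
    simp only [x0, z0]
    rw [this]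
    congr 2
    rw [map_mul]; ring
  have hzm : ∀ i a, z0 i a ∈ Γ := by
    intro i a
    have h := hxy0 i a 1
    rw [mul_one] at h
    have h2 : z0 i a = (x0 (i + 1) 1 * x0 i a)⁻¹ * (x0 i a * x0 (i + 1) 1) := by
      rw [h]; group
    rw [h2]
    exact Γ.mul_mem (Γ.inv_mem (Γ.mul_mem (hxm _ _) (hxm _ _))) (Γ.mul_mem (hxm _ _) (hxm _ _))
  have hTmem : ∀ (i j k : Fin 3) (hij : i ≠ j) (hjk : j ≠ k) (hik : i ≠ k) (a b : R),
      Tv i j hij a ∈ Γ → Tv j k hjk b ∈ Γ → Tv i k hik (a * b) ∈ Γ := by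
    intro i j k hij hjk hik a b ha hb
    have h := Tv_comm i j k hij hjk hik a b
    have h2 : Tv i k hik (a * b) = (Tv j k hjk b * Tv i j hij a)⁻¹ * (Tv i j hij a * Tv j k hjk b) := by
      rw [h]; group
    rw [h2]
    exact Γ.mul_mem (Γ.inv_mem (Γ.mul_mem hb ha)) (Γ.mul_mem ha hb)
  have h01 : (0 : Fin 3) ≠ 1 := by decide
  have h12 : (1 : Fin 3) ≠ 2 := by decide
  have h20 : (2 : Fin 3) ≠ 0 := by decide
  have hb01 : Tv 0 1 h01 (1 : R) ∈ Γ := by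
    have := hxm 0 1
    simpa [x0, w] using this
  have hb12 : Tv 1 2 h12 (1 : R) ∈ Γ := by
    have := hxm 1 1
    simpa [x0, w] using this
  have hb20 : Tv 2 0 h20 (t : R) ∈ Γ := by
    have := hxm 2 1
    simpa [x0, w] using this
  have hb02 : Tv 0 2 h20.symm (1 : R) ∈ Γ := by
    have := hTmem 0 1 2 h01 h12 h20.symm 1 1 hb01 hb12
    simpa using this
  have hpow : ∀ n : ℕ, Tv 0 1 h01 ((t : R) ^ n) ∈ Γ := by
    intro n
    induction n with
    | zero => simpa using hb01
    | succ n ih =>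
      have h1 := hTmem 2 0 1 h20 h01 h12.symm _ _ hb20 ih
      have h2 := hTmem 0 2 1 h20.symm h12.symm h01 _ _ hb02 h1
      rw [one_mul, ← pow_succ'] at h2
      exact h2
  have hall : ∀ c : R, Tv 0 1 h01 c ∈ Γ := by
    intro c
    by_cases hc : c = 0
    · rw [hc, Tv_zero]; exact Γ.one_mem
    · obtain ⟨n, hn⟩ := (mem_powers_iff_mem_zpowers).2 (ht (Units.mk0 c hc))
      have := hpow n
      have h3 : (t : R) ^ n = c := by
        have := congrArg Units.val hn
        simpa using this
      rwa [h3] at this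
  have hft : Fintype Γ := Fintype.ofFinite _
  refine ⟨Γ, inferInstance, hft, fun i a => ⟨x0 i a, hxm i a⟩, fun i a => ⟨z0 i a, hzm i a⟩,
    ?_, ?_, ?_, ?_, ?_, ?_, ?_, ?_, ?_⟩
  · intro i a b
    apply Subtype.ext
    simp only [x0, Subgroup.coe_mul]
    rw [← Tv_add, map_add, mul_add]
  · intro i a b
    apply Subtype.ext
    simp only [z0, Subgroup.coe_mul]
    rw [← Tv_add, map_add, mul_add]
  · intro i a b
    apply Subtype.ext
    exact hxy0 i a b
  · intro i a b
    apply Subtype.ext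
    exact Tv_commute1 i (i+1) (i+1+1) (succ_ne3 i) (succ_ne3' i) _ _
  · intro i a b
    apply Subtype.ext
    exact Tv_commute2 i (i+1) (i+1+1) (succ_ne3 _) (succ_ne3' i) _ _
  · intro S hS
    apply closure_gen
    rintro g ⟨i, a, rfl⟩
    exact hS i a
  · intro i j a b ha h
    have h' : x0 i a = x0 j b := congrArg Subtype.val h
    have hij : i = j := by
      by_contra hij
      have h1 : (x0 i a).1 i (i + 1) = (x0 j b).1 i (i + 1) := by rw [h']
      simp only [x0] at h1
      rw [Tv_entry, Tv_entry' _ _ _ _ _ (succ_ne3 i) (Ne.symm hij)] at h1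
      rcases mul_eq_zero.1 h1 with h2 | h2
      · exact hw i h2
      · exact ha (hφ (by simpa using h2))
    subst hij
    refine ⟨rfl, ?_⟩
    have h1 : (x0 i a).1 i (i + 1) = (x0 i b).1 i (i + 1) := by rw [h']
    simp only [x0] at h1
    rw [Tv_entry, Tv_entry] at h1
    exact hφ (mul_left_cancel₀ (hw i) h1)
  · let ψ : Multiplicative R →* Γ :=
      { toFun := fun c => ⟨Tv 0 1 h01 c.toAdd, hall _⟩
        map_one' := by
          apply Subtype.ext
          exact Tv_zero 0 1 h01
        map_mul' := by
          intro a b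
          apply Subtype.ext
          exact Tv_add 0 1 h01 _ _ }
    have hψ : Function.Injective ψ := by
      intro a b hab
      have h1 : (Tv 0 1 h01 a.toAdd).1 0 1 = (Tv 0 1 h01 b.toAdd).1 0 1 := by
        have : Tv 0 1 h01 a.toAdd = Tv 0 1 h01 b.toAdd := congrArg Subtype.val hab
        rw [this]
      rw [Tv_entry, Tv_entry] at h1
      exact h1
    have := Subgroup.card_dvd_of_injective ψ hψ
    rw [← Nat.card_eq_fintype_card, ← hRcard]
    exact this
  · rw [← Nat.card_eq_fintype_card]
    have h1 : Function.Injective (fun g : Γ => (g.1.1 : Fin 3 → Fin 3 → R)) := by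
      intro a b hab
      exact Subtype.ext (Subtype.ext hab)
    have h2 := Nat.card_le_card_of_injective _ h1
    refine h2.trans ?_
    change Nat.card (Fin 3 → Fin 3 → R) ≤ _
    rw [Nat.card_fun, Nat.card_fun, hRcard]
    simp [← pow_mul]
    apply le_of_eq
    congr 1
    ring

lemma groups_exist {p : ℕ} [Fact p.Prime] (m : ℕ) (hm : m ≠ 0) :
    ∃ (Γ : Type) (_ : Group Γ) (_ : Fintype Γ) (x z : Fin 3 → ZMod p → Γ),
      (∀ i a b, x i (a + b) = x i a * x i b) ∧ (∀ i a b, z i (a + b) = z i a * z i b) ∧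
      (∀ i a b, x i a * x (i + 1) b = x (i + 1) b * x i a * z i (a * b)) ∧
      (∀ i a b, Commute (x i a) (z i b)) ∧ (∀ i a b, Commute (x (i + 1) a) (z i b)) ∧
      (∀ S : Subgroup Γ, (∀ i a, x i a ∈ S) → S = ⊤) ∧
      (∀ i j a b, a ≠ 0 → x i a = x j b → i = j ∧ a = b) ∧
      p ^ m ∣ Fintype.card Γ ∧ Fintype.card Γ ≤ p ^ (9 * m) :=
  groups_exist_aux m (GaloisField p m) (GaloisField.card p m hm) (algebraMap _ _)

/-- The expander family as a labelled regular graph. -/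
lemma expander_exists {p : ℕ} [Fact p.Prime] (hp : p = 37) (r : ℕ) [NeZero r] (hr : 20 ≤ r)
    (m : ℕ) (hm : m ≠ 0) :
    ∃ (Y K : Type) (_ : Fintype Y) (_ : Fintype K) (nb : Y → K → Y) (inv : K → K),
      Nonempty Y ∧ Fintype.card K = 107 + r ∧ (∀ y, Function.Injective (nb y)) ∧
      (∀ y k, nb y k ≠ y) ∧ (∀ y k, nb (nb y k) (inv k) = y) ∧ (∀ k, inv (inv k) = k) ∧
      37 ^ m ∣ Fintype.card Y ∧ Fintype.card Y ≤ 37 ^ (9 * m) * r ∧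
      ∀ f : Y → ℝ, ∑ y, f y * ∑ k, f (nb y k) ≤
        (107 + r) * ∑ y, f y ^ 2 - 20 * ∑ y, (f y - (∑ y', f y') / Fintype.card Y) ^ 2 := by
  classical
  obtain ⟨Γ, _, _, x, z, hx, hz, hxy, hxz, hxz', hgen, hdist, hdvd, hle⟩ := groups_exist (p := p) m hm
  have hx0 : ∀ i, x i 0 = 1 := by
    intro i
    have := hx i 0 0
    rw [add_zero] at this
    exact left_eq_mul.1 this
  have hxneg : ∀ i a, x i a * x i (-a) = 1 := by
    intro i a
    rw [← hx, add_neg_cancel, hx0]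
  have hxne : ∀ i a, a ≠ 0 → x i a ≠ 1 := by
    intro i a ha h
    have := hdist i i a 0 ha (by rw [h, hx0])
    exact ha this.2
  let Y := Γ × Multiplicative (ZMod r)
  let X : Fin 3 → ZMod p → Y := fun i a => (x i a, 1)
  let Z : Fin 3 → ZMod p → Y := fun i a => (z i a, 1)
  let X4 : ZMod r → Y := fun b => (1, Multiplicative.ofAdd b)
  have hgap := cayley_gap (Y := Y) hp X Z r hr X4
    (fun i a b => Prod.ext (hx i a b) (mul_one _).symm) (fun i a b => Prod.ext (hz i a b) (mul_one _).symm)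
    (fun a b => Prod.ext (mul_one _).symm rfl)
    (fun i a b => Prod.ext (hxy i a b) (mul_one _).symm)
    (by intro i a b; exact Prod.ext (hxz i a b) rfl)
    (by intro i a b; exact Prod.ext (hxz' i a b) rfl)
    (by intro i a b; exact Prod.ext ((mul_one _).trans (one_mul _).symm) ((one_mul _).trans (mul_one _).symm))
    (by
      intro S h1 h2
      have h3 := hgen (S.comap (MonoidHom.inl Γ (Multiplicative (ZMod r)))) (fun i a => h1 i a)
      rw [eq_top_iff]
      rintro ⟨g, b⟩ -
      have h4 : g ∈ S.comap (MonoidHom.inl Γ (Multiplicative (ZMod r))) := by rw [h3]; trivial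
      have h5 := S.mul_mem (Subgroup.mem_comap.1 h4) (h2 b.toAdd)
      have h6 : (MonoidHom.inl Γ (Multiplicative (ZMod r))) g * X4 b.toAdd = (g, b) :=
        Prod.ext (mul_one _) (one_mul _)
      rw [← h6]; exact h5)
  let K := (Fin 3 × {a : ZMod p // a ≠ 0}) ⊕ {b : ZMod r // b ≠ 0}
  let g : K → Y := fun k => match k with
    | .inl (i, a) => X i a.1
    | .inr b => X4 b.1
  let inv : K → K := fun k => match k with
    | .inl (i, a) => .inl (i, ⟨-a.1, neg_ne_zero.2 a.2⟩)
    | .inr b => .inr ⟨-b.1, neg_ne_zero.2 b.2⟩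
  refine ⟨Y, K, inferInstance, inferInstance, fun y k => y * g k, inv, ⟨1⟩, ?_, ?_, ?_, ?_, ?_, ?_, ?_, ?_⟩
  · have h1 : Fintype.card {a : ZMod p // a ≠ 0} = 36 := by
      rw [Fintype.card_subtype_compl, ZMod.card]; simp [hp]
    have h2 : Fintype.card {a : ZMod r // a ≠ 0} = r - 1 := by
      rw [Fintype.card_subtype_compl, ZMod.card]; simp
    simp only [K, Fintype.card_sum, Fintype.card_prod, h1, h2, Fintype.card_fin]
    omega
  · intro y k k' h
    have h := mul_left_cancel h
    rcases k with ⟨i, a, ha⟩ | ⟨b, hb⟩ <;> rcases k' with ⟨i', a', ha'⟩ | ⟨b', hb'⟩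
    · have h1 := congrArg Prod.fst h
      obtain ⟨rfl, rfl⟩ := hdist _ _ _ _ ha h1
      rfl
    · have h1 := congrArg Prod.fst h
      exact absurd h1 (hxne i a ha)
    · have h1 := congrArg Prod.fst h
      exact absurd h1.symm (hxne i' a' ha')
    · have h1 : b = b' := congrArg Prod.snd h
      subst h1; rfl
  · intro y k h
    have h := mul_eq_left.1 h
    rcases k with ⟨i, a, ha⟩ | ⟨b, hb⟩
    · exact hxne i a ha (congrArg Prod.fst h)
    · exact hb (congrArg Prod.snd h)
  · intro y k
    have : g k * g (inv k) = 1 := by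
      rcases k with ⟨i, a, ha⟩ | ⟨b, hb⟩
      · exact Prod.ext (hxneg i a) (mul_one _)
      · refine Prod.ext (mul_one _) ?_
        change Multiplicative.ofAdd b * Multiplicative.ofAdd (-b) = 1
        rw [← ofAdd_add, add_neg_cancel, ofAdd_zero]
    simp only [mul_assoc, this, mul_one]
  · intro k
    rcases k with ⟨i, a, ha⟩ | ⟨b, hb⟩ <;> simp [inv]
  · have h1 : Fintype.card Y = Fintype.card Γ * r := by
      simp [Y, ZMod.card]
    rw [h1, ← hp]
    exact hdvd.mul_right r
  · have h1 : Fintype.card Y = Fintype.card Γ * r := by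
      simp [Y, ZMod.card]
    rw [h1, ← hp]
    exact Nat.mul_le_mul_right r hle
  · intro f
    have h1 := hgap f
    have h2 : ∀ y, ∑ i, ∑ a, f (y * X i a) + ∑ b, f (y * X4 b) = ∑ k, f (y * g k) + 4 * f y := by
      intro y
      have e1 : ∀ i, ∑ a, f (y * X i a) = f y + ∑ a : {a : ZMod p // a ≠ 0}, f (y * X i a.1) := by
        intro i
        rw [Fintype.sum_eq_add_sum_subtype_ne _ 0]
        have : X i 0 = 1 := Prod.ext (hx0 i) rfl
        rw [this, mul_one]
      have e2 : ∑ b, f (y * X4 b) = f y + ∑ a : {a : ZMod r // a ≠ 0}, f (y * X4 a.1) := by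
        rw [Fintype.sum_eq_add_sum_subtype_ne _ 0]
        have : X4 0 = 1 := rfl
        rw [this, mul_one]
      rw [e2, Finset.sum_congr rfl (fun i _ => e1 i), Finset.sum_add_distrib]
      simp only [K, Fintype.sum_sum_type, Fintype.sum_prod_type, g]
      simp
      ring
    simp only [h2, mul_add, Finset.sum_add_distrib] at h1
    have h3 : ∑ y, f y * (4 * f y) = 4 * ∑ y, f y ^ 2 := by
      rw [Finset.mul_sum]; exact Finset.sum_congr rfl (fun y _ => by ring)
    rw [h3] at h1
    linarith

section lift

lemma base_le {Y K : Type} [Fintype Y] [Fintype K] (nb : Y → K → Y) (D lam' : ℝ) (q f : Y → ℝ)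
    (hlam : D + 1 < lam') (hf : ∀ y, ∑ k, f (nb y k) + q y * f y = lam' * f y)
    (h : ∑ y, f y * ∑ k, f (nb y k) + ∑ y, q y * f y ^ 2 ≤ (D + 1) * ∑ y, f y ^ 2) :
    ∀ y, f y = 0 := by
  have h1 : ∑ y, f y * ∑ k, f (nb y k) + ∑ y, q y * f y ^ 2 = lam' * ∑ y, f y ^ 2 := by
    rw [← Finset.sum_add_distrib, Finset.mul_sum]
    refine Finset.sum_congr rfl (fun y _ => ?_)
    linear_combination f y * hf y
  have h0 : 0 ≤ ∑ y, f y ^ 2 := Finset.sum_nonneg (fun y _ => sq_nonneg _)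
  have h2 : ∑ y, f y ^ 2 = 0 := by nlinarith
  intro y
  have := (Finset.sum_eq_zero_iff_of_nonneg (fun y _ => sq_nonneg (f y))).1 h2 y (Finset.mem_univ y)
  exact pow_eq_zero_iff (two_ne_zero) |>.1 this

lemma base_small {Y K : Type} [Fintype Y] [Fintype K] (nb : Y → K → Y) (D lam' : ℝ) (q f : Y → ℝ)
    (hgap : ∀ f : Y → ℝ, ∑ y, f y * ∑ k, f (nb y k) ≤
        D * ∑ y, f y ^ 2 - 20 * ∑ y, (f y - (∑ y', f y') / Fintype.card Y) ^ 2)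
    (hlam : D + 1 < lam') (hf : ∀ y, ∑ k, f (nb y k) + q y * f y = lam' * f y)
    (hq : ∀ y, q y ≤ 1) : ∀ y, f y = 0 := by
  refine base_le nb D lam' q f hlam hf ?_
  have h1 := hgap f
  have h2 : 0 ≤ ∑ y, (f y - (∑ y', f y') / Fintype.card Y) ^ 2 :=
    Finset.sum_nonneg (fun y _ => sq_nonneg _)
  have h3 : ∑ y, q y * f y ^ 2 ≤ ∑ y, f y ^ 2 :=
    Finset.sum_le_sum (fun y _ => by nlinarith [hq y, sq_nonneg (f y)])
  linarith

lemma base_avg {Y K : Type} [Fintype Y] [Nonempty Y] [Fintype K] (nb : Y → K → Y) (D lam' : ℝ) (q f : Y → ℝ)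
    (hgap : ∀ f : Y → ℝ, ∑ y, f y * ∑ k, f (nb y k) ≤
        D * ∑ y, f y ^ 2 - 20 * ∑ y, (f y - (∑ y', f y') / Fintype.card Y) ^ 2)
    (hlam : D + 1 < lam') (hf : ∀ y, ∑ k, f (nb y k) + q y * f y = lam' * f y)
    (hq : ∀ y, |q y| ≤ 3) (hqs : ∑ y, q y ≤ Fintype.card Y / 2) : ∀ y, f y = 0 := by
  refine base_le nb D lam' q f hlam hf ?_
  have h1 := hgap f
  set c : ℝ := (∑ y', f y') / Fintype.card Y with hc
  have hN : (0 : ℝ) < Fintype.card Y := by exact_mod_cast Fintype.card_pos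
  have hsum : ∑ y, f y = c * Fintype.card Y := by rw [hc]; field_simp
  have h3 : ∑ y, q y * f y ^ 2 ≤ ∑ y, (c ^ 2 * q y + c ^ 2 / 2 + 21 * (f y - c) ^ 2) := by
    refine Finset.sum_le_sum (fun y _ => ?_)
    obtain ⟨ha, hb⟩ := abs_le.1 (hq y)
    have hq2 : q y ^ 2 ≤ 9 := by nlinarith
    have e1 : 0 ≤ (c - 2 * q y * (f y - c)) ^ 2 := sq_nonneg _
    have e2 : 0 ≤ (9 - q y ^ 2) * (f y - c) ^ 2 := mul_nonneg (by linarith) (sq_nonneg _)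
    have e3 : 0 ≤ (3 - q y) * (f y - c) ^ 2 := mul_nonneg (by linarith) (sq_nonneg _)
    nlinarith
  have h4 : ∑ y, f y ^ 2 = c ^ 2 * Fintype.card Y + ∑ y, (f y - c) ^ 2 := by
    have : ∀ y, f y ^ 2 = (f y - c) ^ 2 + 2 * c * f y - c ^ 2 := fun y => by ring
    rw [Finset.sum_congr rfl (fun y _ => this y), Finset.sum_sub_distrib, Finset.sum_add_distrib,
      ← Finset.mul_sum, hsum]
    simp
    ring
  have h5 : ∑ y, (c ^ 2 * q y + c ^ 2 / 2 + 21 * (f y - c) ^ 2) =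
      c ^ 2 * ∑ y, q y + Fintype.card Y * (c ^ 2 / 2) + 21 * ∑ y, (f y - c) ^ 2 := by
    rw [Finset.sum_add_distrib, Finset.sum_add_distrib, ← Finset.mul_sum, ← Finset.mul_sum]
    simp
  have h6 : c ^ 2 * ∑ y, q y ≤ c ^ 2 * (Fintype.card Y / 2) :=
    mul_le_mul_of_nonneg_left hqs (sq_nonneg c)
  rw [h5] at h3
  nlinarith

lemma base_const {Y K : Type} [Fintype Y] [Nonempty Y] [Fintype K] (nb : Y → K → Y) (D lam' : ℝ) (f : Y → ℝ)
    (hgap : ∀ f : Y → ℝ, ∑ y, f y * ∑ k, f (nb y k) ≤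
        D * ∑ y, f y ^ 2 - 20 * ∑ y, (f y - (∑ y', f y') / Fintype.card Y) ^ 2)
    (hsumA : ∑ y, ∑ k, f (nb y k) = D * ∑ y, f y)
    (hlam : D + 1 < lam') (hf : ∀ y, ∑ k, f (nb y k) + 3 * f y = lam' * f y) :
    ∃ c, ∀ y, f y = c := by
  have h1 := hgap f
  have hN : (0 : ℝ) < Fintype.card Y := by exact_mod_cast Fintype.card_pos
  have h2 : (D + 3 - lam') * ∑ y, f y = 0 := by
    have := Finset.sum_congr (rfl : (Finset.univ : Finset Y) = _) (fun y _ => hf y)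
    rw [Finset.sum_add_distrib, hsumA, ← Finset.mul_sum, ← Finset.mul_sum] at this
    linarith
  have h3 : ∑ y, f y * ∑ k, f (nb y k) = (lam' - 3) * ∑ y, f y ^ 2 := by
    rw [Finset.mul_sum]
    refine Finset.sum_congr rfl (fun y _ => ?_)
    linear_combination f y * hf y
  have h0 : 0 ≤ ∑ y, f y ^ 2 := Finset.sum_nonneg (fun y _ => sq_nonneg _)
  have key : ∑ y, (f y - (∑ y', f y') / Fintype.card Y) ^ 2 = 0 := by
    have hnn : 0 ≤ ∑ y, (f y - (∑ y', f y') / Fintype.card Y) ^ 2 :=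
      Finset.sum_nonneg (fun y _ => sq_nonneg _)
    rcases mul_eq_zero.1 h2 with h | h
    · have : lam' = D + 3 := by linarith
      subst this
      nlinarith
    · simp only [h, zero_div, sub_zero] at h1 hnn ⊢
      nlinarith
  refine ⟨(∑ y', f y') / Fintype.card Y, fun y => ?_⟩
  have := (Finset.sum_eq_zero_iff_of_nonneg (fun y _ => sq_nonneg _)).1 key y (Finset.mem_univ y)
  have := pow_eq_zero_iff (two_ne_zero) |>.1 this
  linarith

variable {I : Type} [Fintype I] [DecidableEq I]

/-- character -/
def chi (T : Finset I) (x : I → ℤˣ) : ℝ := ∏ i ∈ T, ((x i : ℤ) : ℝ)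

lemma chi_mul (T : Finset I) (x y : I → ℤˣ) : chi T (x * y) = chi T x * chi T y := by
  simp [chi, Finset.prod_mul_distrib]

lemma unit_sq (u : ℤˣ) : ((u : ℤ) : ℝ) * ((u : ℤ) : ℝ) = 1 := by
  rcases Int.units_eq_one_or u with h | h <;> simp [h]

lemma chi_sq (T : Finset I) (x : I → ℤˣ) : chi T x * chi T x = 1 := by
  rw [chi, ← Finset.prod_mul_distrib]
  exact Finset.prod_eq_one (fun i _ => unit_sq _)

lemma chi_shift (T : Finset I) (e : I → ℤˣ) (g : (I → ℤˣ) → ℝ) :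
    ∑ x, chi T x * g (e * x) = chi T e * ∑ x, chi T x * g x := by
  rw [← Equiv.sum_comp (Equiv.mulLeft e) (fun x => chi T x * g x), Finset.mul_sum]
  refine Finset.sum_congr rfl (fun x _ => ?_)
  simp only [Equiv.coe_mulLeft, chi_mul]
  linear_combination (- chi T x * g (e * x)) * chi_sq T e

lemma chi_orth (x x' : I → ℤˣ) :
    ∑ T, chi T x * chi T x' = if x = x' then 2 ^ Fintype.card I else 0 := by
  have h : ∑ T, chi T x * chi T x' = ∏ i, (1 + ((x i : ℤ) : ℝ) * ((x' i : ℤ) : ℝ)) := by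
    rw [Finset.prod_one_add]
    simp [chi, Finset.prod_mul_distrib]
  rw [h]
  split_ifs with hx
  · subst hx
    simp only [unit_sq]
    norm_num
  · obtain ⟨i, hi⟩ := Function.ne_iff.1 hx
    refine Finset.prod_eq_zero (Finset.mem_univ i) ?_
    rcases Int.units_eq_one_or (x i) with h1 | h1 <;> rcases Int.units_eq_one_or (x' i) with h2 | h2 <;>
      simp_all

lemma chi_inv (g : (I → ℤˣ) → ℝ) (x : I → ℤˣ) :
    ∑ T, chi T x * ∑ x', chi T x' * g x' = 2 ^ Fintype.card I * g x := by
  simp only [Finset.mul_sum]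
  rw [Finset.sum_comm]
  have : ∀ x', ∑ T, chi T x * (chi T x' * g x') = (if x = x' then 2 ^ Fintype.card I else 0) * g x' := by
    intro x'
    rw [← chi_orth, Finset.sum_mul]
    exact Finset.sum_congr rfl (fun T _ => by ring)
  simp [this]

/-- sign -/
def sg (u j : Fin 3) : ℤˣ := if u = j then -1 else 1

/-- Fourier argument -/
lemma fourier_const {Y K : Type} [Fintype Y] [Nonempty Y] [Fintype K] (nb : Y → K → Y) (D lam' : ℝ)
    (hgap : ∀ f : Y → ℝ, ∑ y, f y * ∑ k, f (nb y k) ≤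
        D * ∑ y, f y ^ 2 - 20 * ∑ y, (f y - (∑ y', f y') / Fintype.card Y) ^ 2)
    (hsumA : ∀ f : Y → ℝ, ∑ y, ∑ k, f (nb y k) = D * ∑ y, f y)
    (hlam : D + 1 < lam') (c : Y → I → Fin 3)
    (hc : ∀ T : Finset I, T ≠ ∅ →
      (∀ y, ∑ j, chi T (fun i => sg (c y i) j) ≤ 1) ∨
      ∑ y, ∑ j, chi T (fun i => sg (c y i) j) ≤ (Fintype.card Y : ℝ) / 2)
    (F : Y → (I → ℤˣ) → ℝ)
    (hF : ∀ y x, ∑ k, F (nb y k) x + ∑ j, F y ((fun i => sg (c y i) j) * x) = lam' * F y x) :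
    ∃ C, ∀ y x, F y x = C := by
  have heq : ∀ (T : Finset I) (y : Y), ∑ k, (∑ x, chi T x * F (nb y k) x) +
      (∑ j, chi T (fun i => sg (c y i) j)) * (∑ x, chi T x * F y x) =
      lam' * ∑ x, chi T x * F y x := by
    intro T y
    rw [Finset.sum_mul]
    simp only [← chi_shift]
    rw [Finset.sum_comm, Finset.sum_comm (s := (Finset.univ : Finset (Fin 3))), ← Finset.sum_add_distrib, Finset.mul_sum]
    refine Finset.sum_congr rfl (fun x _ => ?_)
    rw [← Finset.mul_sum, ← Finset.mul_sum, ← mul_add, hF]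
    ring
  have habs : ∀ (T : Finset I) (y : Y), |∑ j, chi T (fun i => sg (c y i) j)| ≤ 3 := by
    intro T y
    refine (Finset.abs_sum_le_sum_abs _ _).trans ?_
    have : ∀ x : I → ℤˣ, |chi T x| ≤ 1 := by
      intro x
      rw [← sq_le_one_iff_abs_le_one, sq, chi_sq]
    refine (Finset.sum_le_sum (fun j _ => this _)).trans ?_
    simp
  have hz : ∀ T : Finset I, T ≠ ∅ → ∀ y, ∑ x, chi T x * F y x = 0 := by
    intro T hT
    rcases hc T hT with h | h
    · exact base_small nb D lam' (fun y => ∑ j, chi T (fun i => sg (c y i) j)) (fun y => ∑ x, chi T x * F y x) hgap hlam (heq T) h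
    · exact base_avg nb D lam' (fun y => ∑ j, chi T (fun i => sg (c y i) j)) (fun y => ∑ x, chi T x * F y x) hgap hlam (heq T) (habs T) h
  obtain ⟨C, hC⟩ := base_const nb D lam' (fun y => ∑ x, chi ∅ x * F y x) hgap (hsumA (fun y => ∑ x, chi ∅ x * F y x)) hlam (by
    intro y
    have := heq ∅ y
    simpa [chi] using this)
  refine ⟨C / 2 ^ Fintype.card I, fun y x => ?_⟩
  have h := chi_inv (F y) x
  rw [Finset.sum_eq_single ∅ (fun T _ hT => by rw [hz T hT y, mul_zero]) (by simp), hC y] at h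
  rw [eq_div_iff (by positivity), mul_comm, ← h]
  simp [chi]

end lift

/-- colours of digits -/
def col (u : Fin 37) : Fin 3 := if u.1 < 12 then 0 else if u.1 < 24 then 1 else 2

/-- colouring of digit vectors -/
def colr {m : ℕ} (a : Fin m → Fin 37) : Fin m ⊕ Fin 3 → Fin 3 := Sum.elim (fun i => col (a i)) id

/-- sign sums -/
def sig (j : Fin 3) : ℝ := if j = 2 then 11 else 13

lemma sig_eq (j : Fin 3) : ∑ u, ((sg (col u) j : ℤ) : ℝ) = sig j := by
  have h : ∑ u, (sg (col u) j : ℤ) = if j = 2 then 11 else 13 := by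
    revert j; decide +kernel
  have h2 : ((∑ u, (sg (col u) j : ℤ) : ℤ) : ℝ) = sig j := by
    rw [h, sig]; split_ifs <;> simp
  rw [← h2]; push_cast; rfl

lemma sum_prod_L {m : ℕ} (L : Finset (Fin m)) (g : Fin 37 → ℝ) :
    ∑ a : Fin m → Fin 37, ∏ i ∈ L, g (a i) = 37 ^ m * ((∑ u, g u) / 37) ^ L.card := by
  classical
  have h1 : ∀ a : Fin m → Fin 37, ∏ i ∈ L, g (a i) = ∏ i, if i ∈ L then g (a i) else 1 := by
    intro a
    rw [Finset.prod_ite_mem]; simp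
  simp only [h1]
  rw [← Fintype.prod_sum (fun i u => if i ∈ L then g u else 1)]
  have h2 : ∀ i, (∑ u : Fin 37, if i ∈ L then g u else 1) = 37 * if i ∈ L then (∑ u, g u) / 37 else 1 := by
    intro i
    split_ifs
    · field_simp
    · simp
  simp only [h2]
  rw [Finset.prod_mul_distrib, Finset.prod_ite_mem]
  simp [div_pow]

/-- right signs -/
def epsR (S : Finset (Fin 3)) (j : Fin 3) : ℤ := if j ∈ S then -1 else 1

lemma epsR_eq (S : Finset (Fin 3)) (j : Fin 3) : ∏ i ∈ S, (sg i j : ℤ) = epsR S j := by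
  revert S j; decide

lemma chi_colr {m : ℕ} (T : Finset (Fin m ⊕ Fin 3)) (a : Fin m → Fin 37) (j : Fin 3) :
    chi T (fun i => sg (colr a i) j) =
      (∏ i ∈ T.toLeft, ((sg (col (a i)) j : ℤ) : ℝ)) * (epsR T.toRight j : ℝ) := by
  rw [← epsR_eq]
  conv_lhs => rw [chi, ← Finset.toLeft_disjSum_toRight (u := T), Finset.prod_disjSum]
  push_cast
  rfl

lemma sg_sum (u : Fin 3) : ∑ j, (sg u j : ℤ) = 1 := by
  revert u; decide

lemma eps_sum (S : Finset (Fin 3)) (hS : S ≠ ∅) : ∑ j, epsR S j ≤ 1 := by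
  revert S; decide

lemma color_avg (m : ℕ) (T : Finset (Fin m ⊕ Fin 3)) (hT : T ≠ ∅) :
    (∀ a : Fin m → Fin 37, ∑ j, chi T (fun i => sg (colr a i) j) ≤ 1) ∨
    ∑ a : Fin m → Fin 37, ∑ j, chi T (fun i => sg (colr a i) j) ≤ 37 ^ m / 2 := by
  simp only [chi_colr]
  have hsum : ∑ a : Fin m → Fin 37, ∑ j, (∏ i ∈ T.toLeft, ((sg (col (a i)) j : ℤ) : ℝ)) * (epsR T.toRight j : ℝ)
      = 37 ^ m * ∑ j, (sig j / 37) ^ T.toLeft.card * (epsR T.toRight j : ℝ) := by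
    rw [Finset.sum_comm, Finset.mul_sum]
    refine Finset.sum_congr rfl (fun j _ => ?_)
    rw [← Finset.sum_mul, sum_prod_L T.toLeft (fun u => ((sg (col u) j : ℤ) : ℝ)), sig_eq, mul_assoc]
  have hpos : (0 : ℝ) < 37 ^ m := by positivity
  rcases Nat.lt_or_ge T.toLeft.card 2 with h2 | h2
  · by_cases hR : T.toRight = ∅
    · left
      have h1 : T.toLeft.card = 1 := by
        by_contra h
        have h0 : T.toLeft = ∅ := Finset.card_eq_zero.1 (by omega)
        apply hT
        rw [← Finset.toLeft_disjSum_toRight (u := T), h0, hR]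
        rfl
      obtain ⟨i, hi⟩ := Finset.card_eq_one.1 h1
      intro a
      rw [hR, hi]
      simp only [Finset.prod_singleton, epsR]
      have := sg_sum (col (a i))
      have h3 : ∑ j, ((sg (col (a i)) j : ℤ) : ℝ) = 1 := by exact_mod_cast this
      simp [h3]
    · by_cases h0 : T.toLeft = ∅
      · left
        intro a
        rw [h0]
        simp only [Finset.prod_empty, one_mul]
        exact_mod_cast eps_sum _ hR
      · right
        have h1 : T.toLeft.card = 1 := by
          have := Finset.card_pos.2 (Finset.nonempty_iff_ne_empty.2 h0)
          omega
        rw [hsum, h1]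
        have : ∑ j, (sig j / 37) ^ 1 * (epsR T.toRight j : ℝ) ≤ 1 / 2 := by
          have h4 : 13 * epsR T.toRight 0 + 13 * epsR T.toRight 1 + 11 * epsR T.toRight 2 ≤ 15 := by
            revert hR; generalize T.toRight = S; revert S; decide
          have h5 : (13 * epsR T.toRight 0 + 13 * epsR T.toRight 1 + 11 * epsR T.toRight 2 : ℝ) ≤ 15 := by
            exact_mod_cast h4
          rw [Fin.sum_univ_three]
          simp [sig]
          linarith
        nlinarith
  · right
    rw [hsum]
    have : ∑ j, (sig j / 37) ^ T.toLeft.card * (epsR T.toRight j : ℝ) ≤ ∑ j : Fin 3, (1 / 7 : ℝ) := by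
      refine Finset.sum_le_sum (fun j _ => ?_)
      have hs0 : 0 ≤ sig j / 37 := by rw [sig]; split_ifs <;> norm_num
      have hs1 : sig j / 37 ≤ 13 / 37 := by rw [sig]; split_ifs <;> norm_num
      have e1 : (sig j / 37) ^ T.toLeft.card ≤ (sig j / 37) ^ 2 :=
        pow_le_pow_of_le_one hs0 (by linarith) h2
      have e2 : (sig j / 37) ^ 2 ≤ (13 / 37) ^ 2 := pow_le_pow_left₀ hs0 hs1 2
      have e3 : (0 : ℝ) ≤ (sig j / 37) ^ T.toLeft.card := pow_nonneg hs0 _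
      have e4 : (epsR T.toRight j : ℝ) ≤ 1 := by rw [epsR]; split_ifs <;> norm_num
      have e5 : ((13 : ℝ) / 37) ^ 2 ≤ 1 / 7 := by norm_num
      nlinarith
    simp at this
    nlinarith

/-- colouring of a set with cardinality divisible by `37^m` -/
lemma color_exists (Y : Type) [Fintype Y] (m : ℕ) (hd : 37 ^ m ∣ Fintype.card Y) :
    ∃ c : Y → Fin m ⊕ Fin 3 → Fin 3, (∀ y j, c y (Sum.inr j) = j) ∧
    ∀ T : Finset (Fin m ⊕ Fin 3), T ≠ ∅ →
      (∀ y, ∑ j, chi T (fun i => sg (c y i) j) ≤ 1) ∨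
      ∑ y, ∑ j, chi T (fun i => sg (c y i) j) ≤ (Fintype.card Y : ℝ) / 2 := by
  classical
  obtain ⟨N, hN⟩ := hd
  have e : Y ≃ (Fin m → Fin 37) × Fin N := Fintype.equivOfCardEq (by simp [hN])
  refine ⟨fun y => colr (e y).1, fun y j => rfl, fun T hT => ?_⟩
  rcases color_avg m T hT with h | h
  · left; intro y; exact h _
  · right
    rw [Equiv.sum_comp e (fun w => ∑ j, chi T (fun i => sg (colr w.1 i) j)), Fintype.sum_prod_type]
    simp only [Finset.sum_const, Finset.card_univ, Fintype.card_fin, nsmul_eq_mul]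
    rw [← Finset.mul_sum, hN]
    push_cast
    have : (0 : ℝ) ≤ N := by positivity
    nlinarith

lemma phi_indep {Y I : Type} [Nonempty Y] [Fintype I] [DecidableEq I] :
    LinearIndependent ℝ (fun (i : I) (v : Y × (I → ℤˣ)) => ((v.2 i : ℤ) : ℝ)) := by
  rw [Fintype.linearIndependent_iff]
  intro g hg i
  obtain ⟨y⟩ := ‹Nonempty Y›
  have h1 := congrFun hg (y, 1)
  have h2 := congrFun hg (y, Function.update 1 i (-1))
  simp only [Finset.sum_apply, Pi.smul_apply, smul_eq_mul, Pi.zero_apply] at h1 h2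
  have h3 : ∑ j, (g j * (((1 : I → ℤˣ) j : ℤ) : ℝ) - g j * ((Function.update (1 : I → ℤˣ) i (-1) j : ℤ) : ℝ)) = 0 := by
    rw [Finset.sum_sub_distrib, h1, h2, sub_zero]
  rw [Finset.sum_eq_single i] at h3
  · simp at h3; linarith
  · intro j _ hj
    simp [Function.update_of_ne hj]
  · simp

lemma graph_exists (r : ℕ) (hr : 20 ≤ r) (m : ℕ) (hm : m ≠ 0) :
    ∃ n : ℕ, m < n ∧ n ≤ 37 ^ (9 * m) * r * 2 ^ (m + 3) ∧
      ∃ G : SimpleGraph (Fin n), G.Connected ∧ IsRegularGraph G (110 + r) ∧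
        lam (adjMat G) 2 = ((108 + r : ℕ) : ℝ) ∧ m + 3 ≤ eigMult (adjMat G) ((108 + r : ℕ) : ℝ) := by
  classical
  haveI : Fact (Nat.Prime 37) := ⟨by norm_num⟩
  haveI : NeZero r := ⟨by omega⟩
  obtain ⟨Y, K, _, _, nb, inv, hne, hK, hinj, hfix, hinv, hinv2, hdvd, hle, hgap⟩ :=
    expander_exists (p := 37) rfl r hr m hm
  obtain ⟨c, hcr, hc⟩ := color_exists Y m hdvd
  let I := Fin m ⊕ Fin 3
  let V := Y × (I → ℤˣ)
  let e : Fin 3 → Y → (I → ℤˣ) := fun j y i => sg (c y i) j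
  have hee : ∀ j y, e j y * e j y = 1 := by
    intro j y
    funext i
    exact Int.units_mul_self _
  have her : ∀ j j' y, e j y (Sum.inr j') = sg j' j := by
    intro j j' y
    simp only [e, hcr]
  let nb' : V → K ⊕ Fin 3 → V := fun v k => match k with
    | .inl k => (nb v.1 k, v.2)
    | .inr j => (v.1, e j v.1 * v.2)
  have hcardV : Fintype.card V = Fintype.card Y * 2 ^ (m + 3) := by
    simp [V, I]
  let E : V ≃ Fin (Fintype.card V) := Fintype.equivFin V
  have hD : (Fintype.card K : ℝ) = 107 + r := by rw [hK]; push_cast; rfl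
  have hsumA : ∀ f : Y → ℝ, ∑ y, ∑ k, f (nb y k) = (107 + r : ℝ) * ∑ y, f y := by
    intro f
    rw [Finset.sum_comm]
    have : ∀ k, ∑ y, f (nb y k) = ∑ y, f y := by
      intro k
      have hb : Function.Bijective (fun y => nb y k) := by
        refine Finite.injective_iff_bijective.1 ?_
        intro y y' h
        have h' : nb y k = nb y' k := h
        rw [← hinv y k, h', hinv y' k]
      exact hb.sum_comp f
    simp [this, hD]
  have hcardpos : 0 < Fintype.card Y := Fintype.card_pos
  refine ⟨Fintype.card V, ?_, ?_, ?_⟩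
  · rw [hcardV]
    have h1 : m + 3 < 2 ^ (m + 3) := Nat.lt_two_pow_self
    nlinarith
  · rw [hcardV]
    exact Nat.mul_le_mul_right _ hle
  have hcK : Fintype.card (K ⊕ Fin 3) = 110 + r := by
    rw [Fintype.card_sum, hK, Fintype.card_fin]; omega
  have key := assemble (n := Fintype.card V) (K := K ⊕ Fin 3) (fun v k => E (nb' (E.symm v) k))
    ?_ ?_ (Sum.map inv id) ?_ (108 + r) (by rw [hcK]; omega) Fintype.card_pos ?_
    (I := I) (fun i v => (((E.symm v).2 i : ℤ) : ℝ)) ?_ ?_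
  · obtain ⟨G, h1, h2, h3, h4⟩ := key
    rw [hcK] at h2
    refine ⟨G, h1, h2, h3, ?_⟩
    have : Fintype.card I = m + 3 := by simp [I]
    rw [← this]; exact h4
  · -- injective
    intro v k k' h
    have h : nb' (E.symm v) k = nb' (E.symm v) k' := E.injective h
    generalize E.symm v = w at h
    rcases k with k | j <;> rcases k' with k' | j'
    · have := hinj _ (congrArg Prod.fst h)
      rw [this]
    · exact absurd (congrArg Prod.fst h) (hfix _ _)
    · exact absurd (congrArg Prod.fst h).symm (hfix _ _)
    · have h1 : e j w.1 * w.2 = e j' w.1 * w.2 := congrArg Prod.snd h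
      have h2 := congrFun (mul_right_cancel h1) (Sum.inr j)
      rw [her, her] at h2
      have : ∀ j j' : Fin 3, sg j j = sg j j' → j = j' := by decide
      rw [this j j' h2]
  · -- no fixed point
    intro v k h
    have h : nb' (E.symm v) k = E.symm v := by rw [← E.symm_apply_apply (nb' _ _)]; exact congrArg _ h
    generalize E.symm v = w at h
    rcases k with k | j
    · exact hfix _ _ (congrArg Prod.fst h)
    · have h1 : e j w.1 * w.2 = w.2 := congrArg Prod.snd h
      have h2 := congrFun (mul_eq_right.1 h1) (Sum.inr j)
      rw [her] at h2
      have : ∀ j : Fin 3, sg j j ≠ 1 := by decide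
      exact this j h2
  · intro v k
    simp only [Equiv.symm_apply_apply]
    have : nb' (nb' (E.symm v) k) (Sum.map inv id k) = E.symm v := by
      generalize E.symm v = w
      rcases k with k | j
      · exact Prod.ext (hinv _ _) rfl
      · refine Prod.ext rfl ?_
        change e j w.1 * (e j w.1 * w.2) = w.2
        rw [← mul_assoc, hee, one_mul]
    rw [this, Equiv.apply_symm_apply]
  · intro f μ hf hμ
    have h := fourier_const (I := I) nb (107 + r) μ hgap hsumA (by push_cast at hμ; linarith) c hc
      (fun y x => f (E (y, x))) (by
        intro y x
        have := hf (E (y, x))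
        rw [Fintype.sum_sum_type] at this
        simp only [Equiv.symm_apply_apply, nb'] at this
        exact this)
    obtain ⟨C, hC⟩ := h
    refine ⟨C, fun v => ?_⟩
    have := hC (E.symm v).1 (E.symm v).2
    simpa using this
  · have h := phi_indep (Y := Y) (I := I)
    have h2 := h.map' (LinearMap.funLeft ℝ ℝ E.symm)
      (LinearMap.ker_eq_bot.2 (LinearMap.funLeft_injective_of_surjective ℝ ℝ _ E.symm.surjective))
    exact h2
  · intro i v
    simp only [Equiv.symm_apply_apply]
    generalize E.symm v = w
    rw [Fintype.sum_sum_type]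
    have h1 := sg_sum (c w.1 i)
    have h2 : ∑ j, ((sg (c w.1 i) j : ℤ) : ℝ) = 1 := by exact_mod_cast h1
    have h3 : ∀ j, (((nb' w (Sum.inr j)).2 i : ℤ) : ℝ) = ((sg (c w.1 i) j : ℤ) : ℝ) * ((w.2 i : ℤ) : ℝ) := by
      intro j
      change (((e j w.1 i * w.2 i : ℤˣ) : ℤ) : ℝ) = _
      push_cast; rfl
    have h4 : ∀ k, (((nb' w (Sum.inl k)).2 i : ℤ) : ℝ) = ((w.2 i : ℤ) : ℝ) := fun k => rfl
    simp only [h3, h4]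
    rw [← Finset.sum_mul, h2]
    simp [hD]
    ring

theorem stmt_1 :
    ∃ ℓ₀ : ℕ, ∀ ℓ : ℕ, ℓ₀ ≤ ℓ →
      ∃ d : ℕ, 0 < d ∧ ∃ c : ℝ, 0 < c ∧
        {n : ℕ | ∃ G : SimpleGraph (Fin n), G.Connected ∧ IsRegularGraph G d ∧
          lam (adjMat G) 2 = (ℓ : ℝ) ∧
          c * Real.log (Real.log n) ≤ (eigMult (adjMat G) (ℓ : ℝ) : ℝ)}.Infinite := by
  refine ⟨128, fun ℓ hℓ => ?_⟩
  obtain ⟨r, rfl⟩ : ∃ r, ℓ = 108 + r := ⟨ℓ - 108, by omega⟩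
  have hr : 20 ≤ r := by omega
  set C : ℝ := 9 * Real.log 37 + Real.log r + 4 * Real.log 2 with hC
  have hlr : 0 ≤ Real.log r := Real.log_natCast_nonneg r
  have hl37 : 0 < Real.log 37 := Real.log_pos (by norm_num)
  have hl2 : 0 < Real.log 2 := Real.log_pos (by norm_num)
  have hCpos : 0 < C := by positivity
  refine ⟨110 + r, by omega, 1 / C, by positivity, ?_⟩
  apply Set.infinite_of_not_bddAbove
  rintro ⟨M, hM⟩
  obtain ⟨n, hmn, hn, G, h1, h2, h3, h4⟩ := graph_exists r hr (M + 1) (by omega)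
  have hmem := hM (a := n) ⟨G, h1, h2, h3, ?_⟩
  · omega
  · have hn0 : (0 : ℝ) < n := by exact_mod_cast (by omega : 0 < n)
    have hlogn : 0 ≤ Real.log n := Real.log_natCast_nonneg n
    have e1 : Real.log (Real.log n) ≤ Real.log n := Real.log_le_self hlogn
    have hrpos : (0 : ℝ) < r := by exact_mod_cast (by omega : 0 < r)
    have e2 : Real.log n ≤ Real.log ((37 : ℝ) ^ (9 * (M + 1)) * r * 2 ^ (M + 1 + 3)) := by
      apply Real.log_le_log hn0
      exact_mod_cast hn
    rw [Real.log_mul (by positivity) (by positivity), Real.log_mul (by positivity) (by positivity),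
      Real.log_pow, Real.log_pow] at e2
    have e3 : Real.log n ≤ C * (M + 1 : ℝ) := by
      refine e2.trans ?_
      push_cast
      have : (0 : ℝ) ≤ M := by positivity
      rw [hC]
      nlinarith [mul_nonneg this hlr, mul_nonneg this hl2.le]
    have e4 : ((M + 1 + 3 : ℕ) : ℝ) ≤ (eigMult (adjMat G) ((108 + r : ℕ) : ℝ) : ℝ) := by exact_mod_cast h4
    refine le_trans ?_ e4
    rw [one_div, inv_mul_le_iff₀ hCpos]
    push_cast
    nlinarith
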